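/- arXiv:1212.5356 — 3 statements merged into one kernel-verified Lean document; each statement's English description precedes it below -/
import Mathlib

section
/- An element m of the monoid M is the skeleton of some finite (3+1)-free poset if and only if (i) every word in Σ* representing m starts with the letter c_1 or the letter t_1, and (ii) no word in Σ* representing m contains a factor (two consecutive letters) of the form c_i c_i for some i ≥ 1. -/
/-- Two elements of a poset are incomparable. -/
def Incomp {β : Type*} [PartialOrder β] (x y : β) : Prop := ¬ x ≤ y ∧ ¬ y ≤ x

/-- A poset is `(3+1)`-free if it contains no induced subposet consisting of a
3-element chain together with an incomparable extra element. -/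
def ThreePlusOneFree (α : Type*) [PartialOrder α] : Prop :=
  ¬ ∃ a b c d : α, a < b ∧ b < c ∧ Incomp d a ∧ Incomp d b ∧ Incomp d c

variable {α : Type*} [PartialOrder α]

/-- The strict downset `D_a` of a vertex. -/
def Dset (a : α) : Set α := {x | x < a}

/-- The strict upset `U_a` of a vertex. -/
def Uset (a : α) : Set α := {x | a < x}

/-- `a ⊤⊤ b` : the strict downsets of `a` and `b` are incomparable under inclusion. -/
def TTrel (a b : α) : Prop := ¬ Dset a ⊆ Dset b ∧ ¬ Dset b ⊆ Dset a

/-- `a ⊥⊥ b` : the strict upsets of `a` and `b` are incomparable under inclusion. -/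
def BBrel (a b : α) : Prop := ¬ Uset a ⊆ Uset b ∧ ¬ Uset b ⊆ Uset a

/-- The view `v(a) = (D_a, P \ U_a)` of a vertex, an element of `Set α × Set α`
with the componentwise inclusion order; note `v(a) ≤ v(b) ↔ D_a ⊆ D_b ∧ U_b ⊆ U_a`. -/
def view (a : α) : Set α × Set α := (Dset a, (Uset a)ᶜ)

/-- A top of a tangle: a connected component, with at least two vertices, of the graph
on the vertices of `P` with edge relation `⊤⊤`. -/
def IsTopOfTangle (A : Set α) : Prop :=
  2 ≤ A.ncard ∧ ∃ a, A = {b | Relation.ReflTransGen TTrel a b}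

/-- A bottom of a tangle: a connected component, with at least two vertices, of the graph
on the vertices of `P` with edge relation `⊥⊥`. -/
def IsBottomOfTangle (B : Set α) : Prop :=
  2 ≤ B.ncard ∧ ∃ b, B = {a | Relation.ReflTransGen BBrel b a}

/-- A top of a tangle `A` and a bottom of a tangle `B` are matched when they contain the
top and bottom pairs of an induced `(2+2)` subposet. -/
def Matched (A B : Set α) : Prop :=
  ∃ a ∈ A, ∃ a' ∈ A, ∃ b ∈ B, ∃ b' ∈ B,
    b < a ∧ b' < a' ∧ Incomp a a' ∧ Incomp b b' ∧ Incomp a b' ∧ Incomp a' b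

/-- A tangle, regarded as a vertex set: the union of a matched top and bottom. -/
def IsTangle (X : Set α) : Prop :=
  ∃ A B : Set α, IsTopOfTangle A ∧ IsBottomOfTangle B ∧ Matched A B ∧ X = A ∪ B

/-- A vertex lying in no top of a tangle and no bottom of a tangle. -/
def NotInTanglePart (a : α) : Prop :=
  (∀ A : Set α, IsTopOfTangle A → a ∉ A) ∧ (∀ B : Set α, IsBottomOfTangle B → a ∉ B)

/-- A clone set: an equivalence class under "same view" of the vertices lying in no
top or bottom of a tangle. -/
def IsCloneSet (C : Set α) : Prop :=
  ∃ a : α, NotInTanglePart a ∧ C = {b | NotInTanglePart b ∧ view b = view a}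

/-- The parts of a `(3+1)`-free poset: its clone sets and its tangles. -/
def IsPart (X : Set α) : Prop := IsCloneSet X ∨ IsTangle X

/-- The level `ℓ(a)` of a vertex: the maximum number of elements in a chain of `P`
whose greatest element is `a`. -/
noncomputable def level (a : α) : ℕ :=
  sSup {n | ∃ s : Finset α, s.card = n ∧ IsChain (· ≤ ·) (↑s : Set α) ∧ a ∈ s ∧ ∀ x ∈ s, x ≤ a}

/-- A compatible listing of the parts of a `(3+1)`-free poset: an enumeration
`X_1, …, X_k` (each part listed exactly once) such that for vertices in distinct parts,
`a < b` holds exactly when `ℓ(a) ≤ ℓ(b) - 2`, or `ℓ(a) = ℓ(b) - 1` and `i < j`. -/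
noncomputable def CompatibleListing {k : ℕ} (X : Fin k → Set α) : Prop :=
  Function.Injective X ∧ (∀ Y : Set α, IsPart Y ↔ ∃ i, X i = Y) ∧
    ∀ i j : Fin k, i ≠ j → ∀ a ∈ X i, ∀ b ∈ X j,
      (a < b ↔ (level a + 2 ≤ level b ∨ (level a + 1 = level b ∧ i < j)))

/-- The alphabet `Σ = {c_i : i ≥ 1} ∪ {t_i : i ≥ 1}` (where `t_i` stands for
`t_{i,i+1}`). -/
inductive Letter : Type
  | c (i : ℕ+)
  | t (i : ℕ+)
  deriving DecidableEq

/-- The defining relations of the trace monoid `M`: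
`c_i c_j = c_j c_i` for `|i - j| ≥ 2`; `c_i t_j = t_j c_i` for `i ≤ j - 2` or
`i ≥ j + 3`; `t_i t_j = t_j t_i` for `|i - j| ≥ 3`. -/
def SkelRel (u v : FreeMonoid Letter) : Prop :=
  (∃ i j : ℕ+, (i + 2 ≤ j ∨ j + 2 ≤ i) ∧
    u = FreeMonoid.of (.c i) * FreeMonoid.of (.c j) ∧
    v = FreeMonoid.of (.c j) * FreeMonoid.of (.c i)) ∨
  (∃ i j : ℕ+, (i + 2 ≤ j ∨ j + 3 ≤ i) ∧
    u = FreeMonoid.of (.c i) * FreeMonoid.of (.t j) ∧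
    v = FreeMonoid.of (.t j) * FreeMonoid.of (.c i)) ∨
  (∃ i j : ℕ+, (i + 3 ≤ j ∨ j + 3 ≤ i) ∧
    u = FreeMonoid.of (.t i) * FreeMonoid.of (.t j) ∧
    v = FreeMonoid.of (.t j) * FreeMonoid.of (.t i))

/-- The congruence on the free monoid `Σ*` generated by the partial commutation
relations. -/
def SkelCon : Con (FreeMonoid Letter) := conGen SkelRel

/-- The free partially commuting (trace) monoid `M`. -/
abbrev SkelMonoid : Type := SkelCon.Quotient

/-- The image in `M` of a word in `Σ*`. -/
def toSkel (w : List Letter) : SkelMonoid := SkelCon.mk' (FreeMonoid.ofList w)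

/-- The letter of a part in a compatible listing: `c_m` for a clone set at level `m`,
and `t_m` for a tangle straddling levels `{m, m+1}` (bottom at level `m`, top at level
`m+1`). -/
def LetterMatches {α : Type*} [PartialOrder α] (X : Set α) (l : Letter) : Prop :=
  (∃ m : ℕ+, IsCloneSet X ∧ (∀ a ∈ X, level a = (m : ℕ)) ∧ l = Letter.c m) ∨
  (∃ m : ℕ+, (∃ A B : Set α, IsTopOfTangle A ∧ IsBottomOfTangle B ∧ Matched A B ∧
      X = A ∪ B ∧ (∀ b ∈ B, level b = (m : ℕ)) ∧ (∀ a ∈ A, level a = (m : ℕ) + 1)) ∧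
    l = Letter.t m)

/-- `m` is the skeleton of the finite `(3+1)`-free poset `α`: `m` is the image in the
trace monoid of the word obtained from some compatible listing of the parts of `α` by
replacing each clone set at level `i` by `c_i` and each tangle on levels `{i, i+1}`
by `t_i`. -/
def IsSkeletonOf (α : Type*) [Fintype α] [PartialOrder α] (m : SkelMonoid) : Prop :=
  ∃ (w : List Letter) (X : Fin w.length → Set α),
    CompatibleListing X ∧ (∀ i : Fin w.length, LetterMatches (X i) (w.get i)) ∧
    toSkel w = m

section Level

variable [Finite α]

theorem bddAbove_chainCards (a : α) :
    BddAbove {n | ∃ s : Finset α, s.card = n ∧ IsChain (· ≤ ·) (↑s : Set α) ∧ a ∈ s ∧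
      ∀ x ∈ s, x ≤ a} := by
  classical
  have := Fintype.ofFinite α
  refine ⟨Fintype.card α, ?_⟩
  rintro n ⟨s, rfl, -⟩
  exact s.card_le_univ

theorem exists_chain_card_eq_level (a : α) :
    ∃ s : Finset α, s.card = level a ∧ IsChain (· ≤ ·) (↑s : Set α) ∧ a ∈ s ∧
      ∀ x ∈ s, x ≤ a :=
  Nat.sSup_mem (s := {n | ∃ s : Finset α, s.card = n ∧ IsChain (· ≤ ·) (↑s : Set α) ∧ a ∈ s ∧
    ∀ x ∈ s, x ≤ a}) ⟨1, {a}, by simp⟩ (bddAbove_chainCards a)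

theorem card_le_level {a : α} {s : Finset α} (hs : IsChain (· ≤ ·) (↑s : Set α)) (ha : a ∈ s)
    (hle : ∀ x ∈ s, x ≤ a) : s.card ≤ level a :=
  le_csSup (bddAbove_chainCards a) ⟨s, rfl, hs, ha, hle⟩

theorem one_le_level (a : α) : 1 ≤ level a := by
  simpa using card_le_level (a := a) (s := {a}) (by simp) (by simp) (by simp)

theorem level_lt_level {a b : α} (h : a < b) : level a < level b := by
  classical
  obtain ⟨s, hc, hs, -, hle⟩ := exists_chain_card_eq_level a
  have hb : b ∉ s := fun hb => (hle b hb).not_gt h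
  have := card_le_level (a := b) (s := insert b s)
    (by
      rw [Finset.coe_insert]
      exact hs.insert fun x hx _ => Or.inr ((hle x hx).trans h.le))
    (Finset.mem_insert_self _ _)
    (by
      intro x hx
      rcases Finset.mem_insert.1 hx with rfl | hx
      · exact le_rfl
      · exact (hle x hx).trans h.le)
  rw [Finset.card_insert_of_notMem hb] at this
  omega

theorem exists_lt_level_add_one_eq {a : α} (h : 2 ≤ level a) :
    ∃ b, b < a ∧ level b + 1 = level a := by
  classical
  obtain ⟨s, hc, hs, ha, hle⟩ := exists_chain_card_eq_level a
  have hcard : (s.erase a).card + 1 = s.card := Finset.card_erase_add_one ha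
  have hne : (s.erase a).Nonempty := Finset.card_pos.1 (by omega)
  obtain ⟨b, hb⟩ := (s.erase a).exists_maximal hne
  have hbs := Finset.mem_erase.1 hb.prop
  have hba : b < a := lt_of_le_of_ne (hle b hbs.2) hbs.1
  have hchain : IsChain (· ≤ ·) (↑(s.erase a) : Set α) :=
    hs.mono (by exact_mod_cast Finset.erase_subset a s)
  have h1 := card_le_level hchain hb.prop fun x hx => by
    rcases hchain.total hx hb.prop with h | h
    · exact h
    · exact hb.le_of_ge hx h
  have h2 := level_lt_level hba
  exact ⟨b, hba, by omega⟩

theorem level_eq_of_strictMono {f : α → ℕ} (hf : StrictMono f) (hpos : ∀ a, 1 ≤ f a)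
    (hpred : ∀ a, 2 ≤ f a → ∃ b, b < a ∧ f b + 1 = f a) (a : α) : level a = f a := by
  induction hn : f a + level a using Nat.strong_induction_on generalizing a with
  | _ n ih =>
    have h1 := one_le_level a
    have h2 := hpos a
    have hge : level a ≤ f a := by
      by_contra! hlt
      obtain ⟨b, hb, hl⟩ := exists_lt_level_add_one_eq (a := a) (by omega)
      have hfb := hf hb
      have := ih _ (by omega) b rfl
      omega
    by_contra hne
    obtain ⟨b, hb, hl⟩ := hpred a (by omega)
    have hlb := level_lt_level hb
    have := ih _ (by omega) b rfl
    omega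

end Level

section Parts

theorem exists_rel_of_two_le_ncard {β : Type*} {r : β → β → Prop} {a : β}
    (h : 2 ≤ {b | Relation.ReflTransGen r a b}.ncard) : ∃ b, r a b := by
  by_contra! hno
  have : {b | Relation.ReflTransGen r a b} = {a} := by
    ext b
    simp only [Set.mem_ofPred_eq, Set.mem_singleton_iff]
    refine ⟨fun hb => ?_, fun hb => hb ▸ .refl⟩
    rcases hb.cases_head with h | ⟨c, hc, -⟩
    · exact h.symm
    · exact (hno c hc).elim
  rw [this, Set.ncard_singleton] at h
  omega

theorem matched_of_lt {A B : Set α} {a a' b b' : α} (ha : a ∈ A) (ha' : a' ∈ A) (hb : b ∈ B)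
    (hb' : b' ∈ B) (h : b < a) (h' : b' < a') (hn : ¬ b < a') (hn' : ¬ b' < a) :
    Matched A B :=
  ⟨a, ha, a', ha', b, hb, b', hb', h, h',
    ⟨fun H => hn (h.trans_le H), fun H => hn' (h'.trans_le H)⟩,
    ⟨fun H => hn (H.trans_lt h'), fun H => hn' (H.trans_lt h)⟩,
    ⟨fun H => hn (h.trans_le H |>.trans h'),
      fun H => by
        rcases H.eq_or_lt with rfl | H
        · exact hn (h.trans h')
        · exact hn' H⟩,
    ⟨fun H => hn' (h'.trans_le H |>.trans h),
      fun H => by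
        rcases H.eq_or_lt with rfl | H
        · exact hn' (h'.trans h)
        · exact hn H⟩⟩

variable [Finite α]

theorem isTopOfTangle_component {a b : α} (h : TTrel a b) :
    IsTopOfTangle {x | Relation.ReflTransGen TTrel a x} := by
  refine ⟨?_, a, rfl⟩
  refine (Set.one_lt_ncard (Set.toFinite _)).2 ⟨a, .refl, b, .single h, ?_⟩
  rintro rfl
  exact h.1 subset_rfl

theorem isBottomOfTangle_component {a b : α} (h : BBrel a b) :
    IsBottomOfTangle {x | Relation.ReflTransGen BBrel a x} := by
  refine ⟨?_, a, rfl⟩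
  refine (Set.one_lt_ncard (Set.toFinite _)).2 ⟨a, .refl, b, .single h, ?_⟩
  rintro rfl
  exact h.1 subset_rfl

theorem IsTopOfTangle.exists_matched {A : Set α} (hA : IsTopOfTangle A) :
    ∃ B, IsBottomOfTangle B ∧ Matched A B := by
  obtain ⟨hc, a, rfl⟩ := hA
  obtain ⟨a', h⟩ := exists_rel_of_two_le_ncard hc
  obtain ⟨b, hb, hb'⟩ := Set.not_subset.1 h.1
  obtain ⟨c, hc, hc'⟩ := Set.not_subset.1 h.2
  have hbc : BBrel b c := ⟨fun H => hc' (H hb), fun H => hb' (H hc)⟩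
  exact ⟨_, isBottomOfTangle_component hbc,
    matched_of_lt .refl (.single h) .refl (.single hbc) hb hc hb' hc'⟩

theorem IsBottomOfTangle.exists_matched {B : Set α} (hB : IsBottomOfTangle B) :
    ∃ A, IsTopOfTangle A ∧ Matched A B := by
  obtain ⟨hc, b, rfl⟩ := hB
  obtain ⟨b', h⟩ := exists_rel_of_two_le_ncard hc
  obtain ⟨a, ha, ha'⟩ := Set.not_subset.1 h.1
  obtain ⟨c, hc, hc'⟩ := Set.not_subset.1 h.2
  have hac : TTrel a c := ⟨fun H => hc' (H ha), fun H => ha' (H hc)⟩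
  exact ⟨_, isTopOfTangle_component hac,
    matched_of_lt .refl (.single hac) .refl (.single h) ha hc hc' ha'⟩

theorem exists_isPart_mem (a : α) : ∃ Y : Set α, IsPart Y ∧ a ∈ Y := by
  by_cases h : NotInTanglePart a
  · exact ⟨_, Or.inl ⟨a, h, rfl⟩, h, rfl⟩
  · simp only [NotInTanglePart, not_and_or, not_forall, not_not] at h
    rcases h with ⟨A, hA, ha⟩ | ⟨B, hB, ha⟩
    · obtain ⟨B, hB, hM⟩ := hA.exists_matched
      exact ⟨_, Or.inr ⟨A, B, hA, hB, hM, rfl⟩, Or.inl ha⟩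
    · obtain ⟨A, hA, hM⟩ := hB.exists_matched
      exact ⟨_, Or.inr ⟨A, B, hA, hB, hM, rfl⟩, Or.inr ha⟩

end Parts

namespace Letter

/-- The lowest level occupied by a part with the given letter. -/
def base : Letter → ℕ
  | c i => i
  | t i => i

/-- The highest level occupied by a part with the given letter. -/
def peak : Letter → ℕ
  | c i => i
  | t i => i + 1

/-- Two letters are far if no level of one is adjacent or equal to a level of the other. -/
def Far (l l' : Letter) : Prop := l.peak + 2 ≤ l'.base ∨ l'.peak + 2 ≤ l.base

theorem one_le_base (l : Letter) : 1 ≤ l.base := by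
  cases l <;> exact PNat.pos _

theorem base_le_peak (l : Letter) : l.base ≤ l.peak := by
  cases l <;> simp [base, peak]

theorem peak_le_base_add_one (l : Letter) : l.peak ≤ l.base + 1 := by
  cases l <;> simp [base, peak]

theorem base_eq_one_iff {l : Letter} : l.base = 1 ↔ l = c 1 ∨ l = t 1 := by
  cases l <;> simp [base]

end Letter

open Letter in
theorem SkelRel.exists_far {u v : FreeMonoid Letter} (h : SkelRel u v) :
    ∃ l l' : Letter, l.Far l' ∧ u = FreeMonoid.ofList [l, l'] ∧ v = FreeMonoid.ofList [l', l] := by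
  rcases h with ⟨i, j, h, rfl, rfl⟩ | ⟨i, j, h, rfl, rfl⟩ | ⟨i, j, h, rfl, rfl⟩ <;>
  refine ⟨_, _, ?_, rfl, rfl⟩ <;>
  simp only [← PNat.coe_le_coe, PNat.add_coe, PNat.val_ofNat] at h <;>
  simp only [Far, base, peak] <;> omega

section Words

theorem toSkel_append (u v : List Letter) : toSkel (u ++ v) = toSkel u * toSkel v := rfl

theorem toSkel_surjective (m : SkelMonoid) : ∃ w, toSkel w = m := by
  obtain ⟨x, rfl⟩ := SkelCon.mk'_surjective m
  exact ⟨FreeMonoid.toList x, rfl⟩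

theorem toSkel_pair_comm {l l' : Letter} (h : l.Far l') : toSkel [l, l'] = toSkel [l', l] := by
  have key : SkelRel (FreeMonoid.ofList [l, l']) (FreeMonoid.ofList [l', l]) ∨
      SkelRel (FreeMonoid.ofList [l', l]) (FreeMonoid.ofList [l, l']) := by
    rcases l with i | i <;> rcases l' with j | j <;>
      simp only [Letter.Far, Letter.base, Letter.peak] at h
    · refine Or.inl (Or.inl ⟨i, j, ?_, rfl, rfl⟩)
      simp only [← PNat.coe_le_coe, PNat.add_coe, PNat.val_ofNat]
      omega
    · refine Or.inl (Or.inr (Or.inl ⟨i, j, ?_, rfl, rfl⟩))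
      simp only [← PNat.coe_le_coe, PNat.add_coe, PNat.val_ofNat]
      omega
    · refine Or.inr (Or.inr (Or.inl ⟨j, i, ?_, rfl, rfl⟩))
      simp only [← PNat.coe_le_coe, PNat.add_coe, PNat.val_ofNat]
      omega
    · refine Or.inl (Or.inr (Or.inr ⟨i, j, ?_, rfl, rfl⟩))
      simp only [← PNat.coe_le_coe, PNat.add_coe, PNat.val_ofNat]
      omega
  rcases key with h | h
  · exact (Con.eq _).2 (ConGen.Rel.of _ _ h)
  · exact ((Con.eq _).2 (ConGen.Rel.of _ _ h)).symm

theorem toSkel_append_cons {u : List Letter} {l : Letter} (h : ∀ x ∈ u, x.Far l ∨ x = l)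
    (v : List Letter) : toSkel (u ++ l :: v) = toSkel (l :: (u ++ v)) := by
  induction u with
  | nil => rfl
  | cons x u ih =>
    have ih := ih fun y hy => h y (List.mem_cons_of_mem _ hy)
    calc toSkel (x :: u ++ l :: v) = toSkel [x] * toSkel (u ++ l :: v) := rfl
      _ = toSkel [x, l] * toSkel (u ++ v) := by rw [ih]; rfl
      _ = toSkel [l, x] * toSkel (u ++ v) := by
        rcases h x List.mem_cons_self with h | rfl
        · rw [toSkel_pair_comm h]
        · rfl
      _ = toSkel (l :: (x :: u ++ v)) := rfl

/-- If every word equivalent to `w` starts at level one, then in `w` every letter of higher base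
is preceded by a letter occupying the level just below. -/
theorem exists_level_before {w : List Letter}
    (hw : ∀ l w', toSkel (l :: w') = toSkel w → l.base = 1) (u : List Letter) (l : Letter)
    (v : List Letter) (h : w = u ++ l :: v) (hl : 2 ≤ l.base) :
    ∃ x ∈ u, x.base + 1 = l.base ∨ x.peak + 1 = l.base := by
  induction hn : u.length using Nat.strong_induction_on generalizing u l v with
  | _ n ih =>
    by_contra! hno
    have hlow : ∀ k u₁ x u₂, u₁.length = k → u = u₁ ++ x :: u₂ → x.peak + 1 < l.base := by
      intro k
      induction k using Nat.strong_induction_on with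
      | _ k ihk =>
        intro u₁ x u₂ hk hu
        by_contra! hx
        have hxu : x ∈ u := by simp [hu]
        have hx' := hno x hxu
        have := x.peak_le_base_add_one
        obtain ⟨y, hy, hyx⟩ := ih u₁.length (by simp [← hn, hu]) u₁ x (u₂ ++ l :: v)
          (by simp [h, hu]) (by omega) rfl
        obtain ⟨s, r, rfl⟩ := List.append_of_mem hy
        have := ihk s.length (by simp [← hk]) s y (r ++ x :: u₂) rfl (by simp [hu])
        have := y.base_le_peak
        omega
    have hfar : ∀ x ∈ u, x.Far l ∨ x = l := by
      intro x hx
      obtain ⟨s, r, hu⟩ := List.append_of_mem hx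
      have := hlow _ s x r rfl hu
      exact Or.inl (Or.inl (by omega))
    have := hw l (u ++ v) (by rw [h, toSkel_append_cons hfar])
    omega

end Words

section Listings

theorem LetterMatches.base_le_level {X : Set α} {l : Letter} (h : LetterMatches X l) {a : α}
    (ha : a ∈ X) : l.base ≤ level a ∧ level a ≤ l.peak := by
  rcases h with ⟨m, -, h, rfl⟩ | ⟨m, ⟨A, B, -, -, -, rfl, hB, hA⟩, rfl⟩
  · simp [Letter.base, Letter.peak, h a ha]
  · rcases ha with ha | ha
    · simp [Letter.base, Letter.peak, hA a ha]
    · simp [Letter.base, Letter.peak, hB a ha]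

theorem LetterMatches.exists_level_eq_base {X : Set α} {l : Letter} (h : LetterMatches X l) :
    ∃ a ∈ X, level a = l.base := by
  rcases h with ⟨m, ⟨a, ha, rfl⟩, h, rfl⟩ | ⟨m, ⟨A, B, -, ⟨-, b, rfl⟩, -, rfl, hB, hA⟩, rfl⟩
  · exact ⟨a, ⟨ha, rfl⟩, h a ⟨ha, rfl⟩⟩
  · exact ⟨b, Or.inr .refl, hB b .refl⟩

/-- The relation between a part and a later part in a compatible listing. -/
def Precedes (X Y : Set α) : Prop :=
  X ≠ Y ∧ ∀ a ∈ X, ∀ b ∈ Y,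
    (a < b ↔ level a + 1 ≤ level b) ∧ (b < a ↔ level b + 2 ≤ level a)

/-- A compatible listing of the parts of `α`, each part paired with its letter. -/
structure IsLabelledListing (L : List (Set α × Letter)) : Prop where
  isPart_iff : ∀ Y : Set α, IsPart Y ↔ ∃ x ∈ L, x.1 = Y
  letterMatches : ∀ x ∈ L, LetterMatches x.1 x.2
  pairwise : L.Pairwise fun x y => Precedes x.1 y.1

theorem IsLabelledListing.swap {L₁ L₂ : List (Set α × Letter)} {x y : Set α × Letter}
    (h : IsLabelledListing (L₁ ++ x :: y :: L₂)) (hxy : x.2.Far y.2) :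
    IsLabelledListing (L₁ ++ y :: x :: L₂) := by
  have hmem : ∀ z, z ∈ L₁ ++ y :: x :: L₂ ↔ z ∈ L₁ ++ x :: y :: L₂ := by
    intro z; simp only [List.mem_append, List.mem_cons]; tauto
  have hx := h.letterMatches x (by simp)
  have hy := h.letterMatches y (by simp)
  refine ⟨fun Y => ?_, fun z hz => h.letterMatches z ((hmem z).1 hz), ?_⟩
  · simp only [hmem]; exact h.isPart_iff Y
  · have hp := h.pairwise
    simp only [List.pairwise_append, List.pairwise_cons, List.mem_cons, forall_eq_or_imp] at hp ⊢
    obtain ⟨h₁, ⟨⟨hxy', hxL⟩, hyL, h₂⟩, h₃⟩ := hp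
    refine ⟨h₁, ⟨⟨⟨hxy'.1.symm, fun a ha b hb => ?_⟩, hyL⟩, hxL, h₂⟩,
      fun z hz => ⟨(h₃ z hz).2.1, (h₃ z hz).1, (h₃ z hz).2.2⟩⟩
    have key := hxy'.2 b hb a ha
    have h1 := hx.base_le_level hb
    have h2 := hy.base_le_level ha
    rw [key.1, key.2]
    unfold Letter.Far at hxy
    omega

/-- `w` is the word of some compatible listing of the parts of `α`. -/
def IsListingWord (α : Type*) [PartialOrder α] (w : List Letter) : Prop :=
  ∃ L : List (Set α × Letter), IsLabelledListing L ∧ L.map Prod.snd = w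

theorem IsListingWord.swap {u v : List Letter} {l l' : Letter} (hl : l.Far l')
    (h : IsListingWord α (u ++ [l, l'] ++ v)) : IsListingWord α (u ++ [l', l] ++ v) := by
  obtain ⟨L, hL, hw⟩ := h
  simp only [List.append_assoc, List.cons_append, List.nil_append, List.map_eq_append_iff,
    List.map_eq_cons_iff] at hw
  obtain ⟨L₁, _, rfl, rfl, x, _, rfl, rfl, y, L₂, rfl, rfl, rfl⟩ := hw
  exact ⟨_, hL.swap hl, by simp⟩

/-- The congruence of interchangeability in words of compatible listings. -/
def listingCon (α : Type*) [PartialOrder α] : Con (FreeMonoid Letter) where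
  r x y := ∀ u v : List Letter, IsListingWord α (u ++ x.toList ++ v) ↔
    IsListingWord α (u ++ y.toList ++ v)
  iseqv := ⟨fun _ _ _ => Iff.rfl, fun h u v => (h u v).symm,
    fun h h' u v => (h u v).trans (h' u v)⟩
  mul' := by
    intro x y z t h h' u v
    have h1 := h u (z.toList ++ v)
    have h2 := h' (u ++ y.toList) v
    simp only [FreeMonoid.toList_mul, List.append_assoc] at h1 h2 ⊢
    exact h1.trans h2

theorem isListingWord_iff_of_toSkel_eq {w w' : List Letter} (h : toSkel w = toSkel w') :
    IsListingWord α w ↔ IsListingWord α w' := by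
  have hle : SkelCon ≤ listingCon α := by
    refine Con.conGen_le.2 fun x y hxy => ?_
    obtain ⟨l, l', hl, rfl, rfl⟩ := hxy.exists_far
    exact fun u v => ⟨.swap hl, .swap (Or.symm hl)⟩
  have := hle ((Con.eq _).1 h) [] []
  simpa using this

theorem CompatibleListing.isListingWord {w : List Letter} {X : Fin w.length → Set α}
    (hX : CompatibleListing X) (hw : ∀ i, LetterMatches (X i) (w.get i)) :
    IsListingWord α w := by
  obtain ⟨hinj, hpart, hlt⟩ := hX
  refine ⟨List.ofFn fun i => (X i, w.get i), ⟨fun Y => ?_, ?_, ?_⟩, ?_⟩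
  · rw [hpart]
    simp [List.mem_ofFn]
  · intro x hx
    obtain ⟨i, rfl⟩ := (List.mem_ofFn).1 hx
    exact hw i
  · rw [List.pairwise_ofFn]
    intro i j hij
    refine ⟨hinj.ne hij.ne, fun a ha b hb => ?_⟩
    have h1 := hlt i j hij.ne a ha b hb
    have h2 := hlt j i hij.ne' b hb a ha
    have h3 := hij.not_gt
    simp only [hij, and_true] at h1
    simp only [h3, and_false, or_false] at h2
    rw [h1, h2]
    omega
  · rw [List.map_ofFn]
    exact List.ofFn_get w

variable [Finite α]

theorem IsListingWord.base_head {l : Letter} {w : List Letter} (h : IsListingWord α (l :: w)) :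
    l.base = 1 := by
  obtain ⟨L, hL, hw⟩ := h
  obtain ⟨x, L, rfl, rfl, -⟩ := List.map_eq_cons_iff.1 hw
  by_contra hne
  have h1 := x.2.one_le_base
  have hx := hL.letterMatches x (by simp)
  obtain ⟨a, ha, hla⟩ := hx.exists_level_eq_base
  obtain ⟨b, hb, hlb⟩ := exists_lt_level_add_one_eq (a := a) (by omega)
  obtain ⟨Y, hY, hbY⟩ := exists_isPart_mem b
  obtain ⟨y, hy, rfl⟩ := (hL.isPart_iff Y).1 hY
  rcases List.mem_cons.1 hy with rfl | hy
  · have := hx.base_le_level hbY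
    omega
  · have := ((List.pairwise_cons.1 hL.pairwise).1 y hy).2 a ha b hbY
    have := this.2.1 hb
    omega

theorem not_isListingWord_of_c_c (i : ℕ+) (u v : List Letter) :
    ¬ IsListingWord α (u ++ [Letter.c i, Letter.c i] ++ v) := by
  rintro ⟨L, hL, hw⟩
  simp only [List.append_assoc, List.cons_append, List.nil_append, List.map_eq_append_iff,
    List.map_eq_cons_iff] at hw
  obtain ⟨L₁, _, rfl, rfl, x, _, rfl, hx, y, L₂, rfl, hy, rfl⟩ := hw
  have hxm := hL.letterMatches x (by simp)
  have hym := hL.letterMatches y (by simp)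
  have hlev : ∀ z ∈ ({x, y} : Set (Set α × Letter)), ∀ d ∈ z.1, level d = i := by
    rintro z (rfl | rfl) d hd
    · have := hxm.base_le_level hd
      rw [hx] at this
      exact le_antisymm this.2 this.1
    · have := hym.base_le_level hd
      rw [hy] at this
      exact le_antisymm this.2 this.1
  have hclone : ∀ {X : Set α}, LetterMatches X (Letter.c i) → IsCloneSet X := by
    rintro X (⟨m, h, -⟩ | ⟨m, -, h⟩)
    · exact h
    · cases h
  rw [hx] at hxm
  rw [hy] at hym
  obtain ⟨a, ha, hxa⟩ := hclone hxm
  obtain ⟨b, hb, hyb⟩ := hclone hym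
  have hax : a ∈ x.1 := by rw [hxa]; exact ⟨ha, rfl⟩
  have hby : b ∈ y.1 := by rw [hyb]; exact ⟨hb, rfl⟩
  have hla := hlev x (by simp) a hax
  have hlb := hlev y (by simp) b hby
  have hp := hL.pairwise
  simp only [List.pairwise_append, List.pairwise_cons, List.mem_cons, forall_eq_or_imp] at hp
  obtain ⟨-, ⟨⟨hxy, hxL⟩, hyL, -⟩, h₁⟩ := hp
  have key : ∀ z, (z < a ↔ z < b) ∧ (a < z ↔ b < z) := by
    intro z
    obtain ⟨Z, hZ, hzZ⟩ := exists_isPart_mem z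
    obtain ⟨t, ht, rfl⟩ := (hL.isPart_iff Z).1 hZ
    have hsame : level z = i → (z < a ↔ z < b) ∧ (a < z ↔ b < z) := by
      intro hz
      have h1 : ¬ z < a := fun h => by have := level_lt_level h; omega
      have h2 : ¬ z < b := fun h => by have := level_lt_level h; omega
      have h3 : ¬ a < z := fun h => by have := level_lt_level h; omega
      have h4 : ¬ b < z := fun h => by have := level_lt_level h; omega
      tauto
    simp only [List.mem_append, List.mem_cons] at ht
    rcases ht with ht | rfl | rfl | ht
    · have h2 := (h₁ t ht).1.2 z hzZ a hax
      have h3 := (h₁ t ht).2.1.2 z hzZ b hby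
      rw [h2.1, h2.2, h3.1, h3.2, hla, hlb]
      exact ⟨Iff.rfl, Iff.rfl⟩
    · exact hsame (hlev t (by simp) z hzZ)
    · exact hsame (hlev t (by simp) z hzZ)
    · have h2 := (hxL t ht).2 a hax z hzZ
      have h3 := (hyL t ht).2 b hby z hzZ
      rw [h2.1, h2.2, h3.1, h3.2, hla, hlb]
      exact ⟨Iff.rfl, Iff.rfl⟩
  have hview : view a = view b :=
    Prod.ext (Set.ext fun z => (key z).1) (Set.ext fun z => not_congr (key z).2)
  exact hxy.1 (by rw [hxa, hyb, hview])

end Listings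

section Construction

/-- A realization of a word as a poset: every letter `c i` contributes one vertex at level `i`,
every letter `t i` an induced `(2+2)` subposet on levels `i` and `i + 1`. A vertex is determined by
the position of its letter, its height above the base of that letter, and the tag of its chain. -/
structure WordModel (w : List Letter) (α : Type*) [PartialOrder α] where
  pos : α → Fin w.length
  up : α → ℕ
  tag : α → ℕ
  ext : ∀ {a b}, pos a = pos b → up a = up b → tag a = tag b → a = b
  up_le : ∀ a, (w.get (pos a)).base + up a ≤ (w.get (pos a)).peak
  tag_le : ∀ a, (w.get (pos a)).base + tag a ≤ (w.get (pos a)).peak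
  exists_vertex : ∀ p s k, (w.get p).base + s ≤ (w.get p).peak →
    (w.get p).base + k ≤ (w.get p).peak → ∃ a, pos a = p ∧ up a = s ∧ tag a = k
  lt_iff : ∀ a b, a < b ↔
    (w.get (pos a)).base + up a + 2 ≤ (w.get (pos b)).base + up b ∨
    ((w.get (pos a)).base + up a + 1 = (w.get (pos b)).base + up b ∧
      ((pos a : ℕ) < pos b ∨ ((pos a : ℕ) = pos b ∧ tag a = tag b)))

namespace WordModel

variable {w : List Letter} (M : WordModel w α)

/-- The intended level of a vertex. -/
def lev (a : α) : ℕ := (w.get (M.pos a)).base + M.up a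

theorem lt_iff_lev (a b : α) : a < b ↔ M.lev a + 2 ≤ M.lev b ∨
    (M.lev a + 1 = M.lev b ∧
      ((M.pos a : ℕ) < M.pos b ∨ ((M.pos a : ℕ) = M.pos b ∧ M.tag a = M.tag b))) :=
  M.lt_iff a b

theorem up_le_one (a : α) : M.up a ≤ 1 := by
  have := M.up_le a
  have := (w.get (M.pos a)).peak_le_base_add_one
  omega

theorem lev_add_up {a b : α} (h : (M.pos a : ℕ) = M.pos b) :
    M.lev a + M.up b = M.lev b + M.up a := by
  unfold lev
  rw [Fin.ext h]
  omega

theorem one_le_lev (a : α) : 1 ≤ M.lev a :=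
  (Letter.one_le_base _).trans (Nat.le_add_right _ _)

theorem strictMono_lev : StrictMono M.lev := by
  intro a b h
  rw [M.lt_iff_lev] at h
  omega

theorem threePlusOneFree (M : WordModel w α) : ThreePlusOneFree α := by
  rintro ⟨a, b, c, d, hab, hbc, hda, hdb, hdc⟩
  have h1 : ¬ a < d := fun h => hda.2 h.le
  have h2 : ¬ d < c := fun h => hdc.1 h.le
  rw [M.lt_iff_lev] at hab hbc h1 h2
  have h3 := M.up_le_one a
  have h4 := M.up_le_one c
  have h5 := M.lev_add_up (a := a) (b := c)
  omega

theorem exists_pred (hw : ∀ l w', toSkel (l :: w') = toSkel w → l.base = 1) (a : α)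
    (ha : 2 ≤ M.lev a) : ∃ b, b < a ∧ M.lev b + 1 = M.lev a := by
  by_cases hup : M.up a = 0
  · have hsplit : w = w.take (M.pos a) ++ w.get (M.pos a) :: w.drop (M.pos a + 1) := by
      simp
    obtain ⟨x, hx, hxl⟩ := exists_level_before hw _ _ _ hsplit (by unfold lev at ha; omega)
    obtain ⟨r, hr, rfl⟩ := List.mem_take_iff_getElem.1 hx
    obtain ⟨hrp, hrw⟩ := lt_min_iff.1 hr
    obtain ⟨s, hs, hsl⟩ : ∃ s, (w.get ⟨r, hrw⟩).base + s ≤ (w.get ⟨r, hrw⟩).peak ∧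
        (w.get ⟨r, hrw⟩).base + s + 1 = (w.get (M.pos a)).base := by
      have := (w.get ⟨r, hrw⟩).base_le_peak
      simp only [List.get_eq_getElem] at hxl this ⊢
      rcases hxl with h | h
      · exact ⟨0, by omega, by omega⟩
      · exact ⟨w[r].peak - w[r].base, by omega, by omega⟩
    obtain ⟨b, hb, hbu, -⟩ := M.exists_vertex ⟨r, hrw⟩ s 0 hs (Letter.base_le_peak _)
    have hlb : M.lev b + 1 = M.lev a := by
      unfold lev
      rw [hb, hbu, hup]
      omega
    exact ⟨b, (M.lt_iff_lev _ _).2 (Or.inr ⟨hlb, Or.inl (by rw [hb]; exact hrp)⟩), hlb⟩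
  · have := M.up_le_one a
    obtain ⟨b, hb, hbu, hbt⟩ := M.exists_vertex (M.pos a) 0 (M.tag a) (Letter.base_le_peak _)
      (M.tag_le a)
    have hpos : (M.pos b : ℕ) = M.pos a := by rw [hb]
    have := M.lev_add_up hpos
    exact ⟨b, (M.lt_iff_lev _ _).2 (Or.inr ⟨by omega, Or.inr ⟨hpos, hbt⟩⟩), by omega⟩

theorem level_eq [Finite α] (hw : ∀ l w', toSkel (l :: w') = toSkel w → l.base = 1) (a : α) :
    level a = M.lev a :=
  level_eq_of_strictMono M.strictMono_lev M.one_le_lev (M.exists_pred hw) a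

theorem tTrel_iff {a b : α} :
    TTrel a b ↔ M.pos a = M.pos b ∧ M.up a = 1 ∧ M.up b = 1 ∧ M.tag a ≠ M.tag b := by
  constructor
  · rintro ⟨h, h'⟩
    obtain ⟨c, hca, hcb⟩ := Set.not_subset.1 h
    obtain ⟨d, hdb, hda⟩ := Set.not_subset.1 h'
    simp only [Dset, Set.mem_ofPred_eq, M.lt_iff_lev] at hca hcb hdb hda
    have h1 := M.up_le_one a
    have h2 := M.up_le_one b
    have hpa : (M.pos a : ℕ) = M.pos c := by omega
    have hpb : (M.pos b : ℕ) = M.pos c := by omega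
    have h3 := M.lev_add_up hpa
    have h4 := M.lev_add_up hpb
    exact ⟨Fin.ext (by omega), by omega, by omega, by omega⟩
  · rintro ⟨hp, ha, hb, ht⟩
    have key : ∀ {x y}, M.pos x = M.pos y → M.up x = 1 → M.up y = 1 → M.tag x ≠ M.tag y →
        ¬ Dset x ⊆ Dset y := by
      intro x y hp hx hy ht hsub
      obtain ⟨c, hc, hcu, hct⟩ := M.exists_vertex (M.pos x) 0 (M.tag x) (Letter.base_le_peak _)
        (M.tag_le x)
      have hcx : (M.pos c : ℕ) = M.pos x := by rw [hc]
      have hcy : (M.pos c : ℕ) = M.pos y := by rw [hc, hp]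
      have h1 := M.lev_add_up hcx
      have h2 := M.lev_add_up hcy
      have h3 : c < y := hsub ((M.lt_iff_lev c x).2 (by omega))
      rw [M.lt_iff_lev] at h3
      omega
    exact ⟨key hp ha hb ht, key hp.symm hb ha ht.symm⟩

theorem bBrel_iff {a b : α} :
    BBrel a b ↔ M.pos a = M.pos b ∧ M.up a = 0 ∧ M.up b = 0 ∧ M.tag a ≠ M.tag b := by
  constructor
  · rintro ⟨h, h'⟩
    obtain ⟨c, hca, hcb⟩ := Set.not_subset.1 h
    obtain ⟨d, hdb, hda⟩ := Set.not_subset.1 h'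
    simp only [Uset, Set.mem_ofPred_eq, M.lt_iff_lev] at hca hcb hdb hda
    have h1 := M.up_le_one c
    have hpa : (M.pos a : ℕ) = M.pos c := by omega
    have hpb : (M.pos b : ℕ) = M.pos c := by omega
    have h3 := M.lev_add_up hpa
    have h4 := M.lev_add_up hpb
    exact ⟨Fin.ext (by omega), by omega, by omega, by omega⟩
  · rintro ⟨hp, ha, hb, ht⟩
    have key : ∀ {x y}, M.pos x = M.pos y → M.up x = 0 → M.up y = 0 → M.tag x ≠ M.tag y →
        ¬ Uset x ⊆ Uset y := by
      intro x y hp hx hy ht hsub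
      have hx1 := M.tag_le x
      have hy1 := M.tag_le y
      rw [← hp] at hy1
      obtain ⟨c, hc, hcu, hct⟩ := M.exists_vertex (M.pos x) 1 (M.tag x) (by omega) (M.tag_le x)
      have hcx : (M.pos c : ℕ) = M.pos x := by rw [hc]
      have hcy : (M.pos c : ℕ) = M.pos y := by rw [hc, hp]
      have h1 := M.lev_add_up hcx
      have h2 := M.lev_add_up hcy
      have h3 : y < c := hsub ((M.lt_iff_lev x c).2 (by omega))
      rw [M.lt_iff_lev] at h3
      omega
    exact ⟨key hp ha hb ht, key hp.symm hb ha ht.symm⟩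

theorem component_iff [Finite α] {r : α → α → Prop} {s : ℕ} (hs : s ≤ 1)
    (hr : ∀ a b, r a b ↔ M.pos a = M.pos b ∧ M.up a = s ∧ M.up b = s ∧ M.tag a ≠ M.tag b)
    (A : Set α) :
    (2 ≤ A.ncard ∧ ∃ a, A = {b | Relation.ReflTransGen r a b}) ↔
      ∃ p, (w.get p).base < (w.get p).peak ∧ A = {x | M.pos x = p ∧ M.up x = s} := by
  have key : ∀ {a b}, r a b →
      {x | Relation.ReflTransGen r a x} = {x | M.pos x = M.pos a ∧ M.up x = s} := by
    intro a b hab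
    ext x
    constructor
    · intro h
      have ha := ((hr a b).1 hab).2.1
      induction (show Relation.ReflTransGen r a x from h) with
      | refl => exact ⟨rfl, ha⟩
      | tail _ hyx ih =>
        have hyx := (hr _ _).1 hyx
        exact ⟨hyx.1.symm.trans (ih ‹_›).1, hyx.2.2.1⟩
    · rintro ⟨hp, hx⟩
      have ha := ((hr a b).1 hab).2.1
      by_cases ht : M.tag x = M.tag a
      · rw [M.ext hp (hx.trans ha.symm) ht]
        exact .refl
      · exact .single ((hr a x).2 ⟨hp.symm, ha, hx, Ne.symm ht⟩)
  constructor
  · rintro ⟨hc, a, rfl⟩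
    obtain ⟨b, hab⟩ := exists_rel_of_two_le_ncard hc
    refine ⟨M.pos a, ?_, key hab⟩
    obtain ⟨hp, -, -, ht⟩ := (hr a b).1 hab
    have h1 := M.tag_le a
    have h2 := M.tag_le b
    rw [← hp] at h2
    omega
  · rintro ⟨p, hp, rfl⟩
    obtain ⟨a, ha, hau, hat⟩ := M.exists_vertex p s 0 (by omega) (by omega)
    obtain ⟨b, hb, hbu, hbt⟩ := M.exists_vertex p s 1 (by omega) (by omega)
    have hab : r a b := (hr a b).2 ⟨ha.trans hb.symm, hau, hbu, by omega⟩
    refine ⟨(Set.one_lt_ncard (Set.toFinite _)).2 ⟨a, ⟨ha, hau⟩, b, ⟨hb, hbu⟩, ?_⟩, a, ?_⟩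
    · rintro rfl
      omega
    · rw [key hab, ha]

theorem setOf_pos_eq (p : Fin w.length) : {x | M.pos x = p} =
    {x | M.pos x = p ∧ M.up x = 1} ∪ {x | M.pos x = p ∧ M.up x = 0} := by
  ext x
  have := M.up_le_one x
  simp only [Set.mem_ofPred_eq, Set.mem_union, ← and_or_left]
  exact ⟨fun h => ⟨h, by omega⟩, And.left⟩

theorem matched_iff {p q : Fin w.length} (hp : (w.get p).base < (w.get p).peak) :
    Matched {x | M.pos x = p ∧ M.up x = 1} {x | M.pos x = q ∧ M.up x = 0} ↔ p = q := by
  constructor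
  · rintro ⟨a, ⟨rfl, ha⟩, a', ⟨hp', ha'⟩, b, ⟨rfl, hb⟩, b', -, hlt, -, -, -, -, h⟩
    have h1 : ¬ b < a' := fun H => h.2 H.le
    have h2 := M.lev_add_up (congrArg Fin.val hp')
    have h3 := congrArg Fin.val hp'
    rw [M.lt_iff_lev] at hlt h1
    exact Fin.ext (by omega)
  · rintro rfl
    obtain ⟨a, ha, hau, hat⟩ := M.exists_vertex p 1 0 (by omega) (by omega)
    obtain ⟨a', ha', hau', hat'⟩ := M.exists_vertex p 1 1 (by omega) (by omega)
    obtain ⟨b, hb, hbu, hbt⟩ := M.exists_vertex p 0 0 (by omega) (by omega)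
    obtain ⟨b', hb', hbu', hbt'⟩ := M.exists_vertex p 0 1 (by omega) (by omega)
    refine matched_of_lt ⟨ha, hau⟩ ⟨ha', hau'⟩ ⟨hb, hbu⟩ ⟨hb', hbu'⟩ ?_ ?_ ?_ ?_ <;>
    simp [M.lt_iff, ha, ha', hb, hb', hau, hau', hbu, hbu', hat, hat', hbt, hbt']

section Finite

variable [Finite α]

theorem isTopOfTangle_iff (A : Set α) : IsTopOfTangle A ↔
    ∃ p, (w.get p).base < (w.get p).peak ∧ A = {x | M.pos x = p ∧ M.up x = 1} :=
  M.component_iff le_rfl (fun _ _ => M.tTrel_iff) A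

theorem isBottomOfTangle_iff (B : Set α) : IsBottomOfTangle B ↔
    ∃ p, (w.get p).base < (w.get p).peak ∧ B = {x | M.pos x = p ∧ M.up x = 0} :=
  M.component_iff zero_le_one (fun _ _ => M.bBrel_iff) B

theorem isTangle_iff (Y : Set α) : IsTangle Y ↔
    ∃ p, (w.get p).base < (w.get p).peak ∧ {x | M.pos x = p} = Y := by
  constructor
  · rintro ⟨A, B, hA, hB, hM, rfl⟩
    obtain ⟨p, hp, rfl⟩ := (M.isTopOfTangle_iff A).1 hA
    obtain ⟨q, -, rfl⟩ := (M.isBottomOfTangle_iff B).1 hB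
    obtain rfl := (M.matched_iff hp).1 hM
    exact ⟨p, hp, M.setOf_pos_eq p⟩
  · rintro ⟨p, hp, rfl⟩
    exact ⟨_, _, (M.isTopOfTangle_iff _).2 ⟨p, hp, rfl⟩, (M.isBottomOfTangle_iff _).2 ⟨p, hp, rfl⟩,
      (M.matched_iff hp).2 rfl, M.setOf_pos_eq p⟩

theorem notInTanglePart_iff (a : α) : NotInTanglePart a ↔
    (w.get (M.pos a)).base = (w.get (M.pos a)).peak := by
  constructor
  · rintro ⟨h, h'⟩
    by_contra hne
    have hlt := lt_of_le_of_ne (Letter.base_le_peak _) hne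
    have := M.up_le_one a
    obtain hu | hu : M.up a = 1 ∨ M.up a = 0 := by omega
    · exact h _ ((M.isTopOfTangle_iff _).2 ⟨M.pos a, hlt, rfl⟩) ⟨rfl, hu⟩
    · exact h' _ ((M.isBottomOfTangle_iff _).2 ⟨M.pos a, hlt, rfl⟩) ⟨rfl, hu⟩
  · intro h
    constructor
    · rintro A hA ha
      obtain ⟨p, hp, rfl⟩ := (M.isTopOfTangle_iff A).1 hA
      obtain ⟨rfl, -⟩ := ha
      omega
    · rintro A hA ha
      obtain ⟨p, hp, rfl⟩ := (M.isBottomOfTangle_iff A).1 hA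
      obtain ⟨rfl, -⟩ := ha
      omega

end Finite

theorem pos_not_lt_of_view_eq (hw : ∀ l w', toSkel (l :: w') = toSkel w → l.base = 1)
    (hw' : ∀ i u v, toSkel (u ++ [Letter.c i, Letter.c i] ++ v) ≠ toSkel w) {a b : α}
    (ha : (w.get (M.pos a)).base = (w.get (M.pos a)).peak)
    (hb : (w.get (M.pos b)).base = (w.get (M.pos b)).peak) (hv : view a = view b) :
    ¬ M.pos a < M.pos b := by
  intro hlt
  have hD : ∀ z, z < a ↔ z < b := fun z => Set.ext_iff.1 (congrArg Prod.fst hv) z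
  have hU : ∀ z, a < z ↔ b < z := fun z => by
    have := Set.ext_iff.1 (congrArg Prod.snd hv) z
    exact not_iff_not.1 this
  have hua := M.up_le a
  have hub := M.up_le b
  have hlev : M.lev a = M.lev b := by
    have key : ∀ {x y}, (∀ z, z < x ↔ z < y) → M.lev x ≤ M.lev y := by
      intro x y h
      by_contra! hlt
      have := M.one_le_lev y
      obtain ⟨z, hz, hzl⟩ := M.exists_pred hw x (by omega)
      have := M.strictMono_lev ((h z).1 hz)
      omega
    exact (key hD).antisymm (key fun z => (hD z).symm)
  obtain ⟨i, hi⟩ : ∃ i, w.get (M.pos a) = Letter.c i := by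
    cases h : w.get (M.pos a) with
    | c i => exact ⟨i, rfl⟩
    | t i => simp only [h, Letter.base, Letter.peak] at ha; omega
  obtain ⟨j, hj⟩ : ∃ j, w.get (M.pos b) = Letter.c j := by
    cases h : w.get (M.pos b) with
    | c j => exact ⟨j, rfl⟩
    | t j => simp only [h, Letter.base, Letter.peak] at hb; omega
  have hla : M.lev a = i := by
    unfold lev; rw [hi] at hua ⊢; simp only [Letter.base, Letter.peak] at hua ⊢; omega
  have hlb : M.lev b = j := by
    unfold lev; rw [hj] at hub ⊢; simp only [Letter.base, Letter.peak] at hub ⊢; omega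
  obtain rfl : i = j := PNat.coe_injective (by omega)
  have hbetween : ∀ r : Fin w.length, M.pos a < r → r < M.pos b →
      (w.get r).Far (Letter.c i) ∨ w.get r = Letter.c i := by
    intro r har hrb
    have hno : ∀ z, M.pos z = r → M.lev z + 1 ≠ i ∧ M.lev z ≠ i + 1 := by
      rintro z rfl
      have har := Fin.lt_def.1 har
      have hrb := Fin.lt_def.1 hrb
      have h1 := hD z
      have h2 := hU z
      rw [M.lt_iff_lev, M.lt_iff_lev] at h1 h2
      omega
    obtain ⟨x, hx, hxu, -⟩ := M.exists_vertex r 0 0 (Letter.base_le_peak _)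
      (Letter.base_le_peak _)
    have hxn := hno x hx
    unfold lev at hxn
    rw [hx, hxu] at hxn
    cases hr : w.get r with
    | c k =>
      simp only [hr, Letter.base, Letter.Far, Letter.peak, Letter.c.injEq, ← PNat.coe_inj] at hxn ⊢
      omega
    | t k =>
      obtain ⟨y, hy, hyu, -⟩ := M.exists_vertex r 1 0 (by rw [hr]; exact le_rfl)
        (Letter.base_le_peak _)
      have hyn := hno y hy
      unfold lev at hyn
      rw [hy, hyu] at hyn
      simp only [hr, Letter.base, Letter.Far, Letter.peak] at hxn hyn ⊢
      omega
  have hlt' := Fin.lt_def.1 hlt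
  have hsplit : w = w.take (M.pos a) ++ (Letter.c i :: ((w.take (M.pos b)).drop (M.pos a + 1) ++
      Letter.c i :: w.drop (M.pos b + 1))) := by
    have h1 : w = w.take (M.pos b) ++ w.get (M.pos b) :: w.drop (M.pos b + 1) := by simp
    have h2 : w.take (M.pos b) = (w.take (M.pos b)).take (M.pos a) ++
        w.get (M.pos a) :: (w.take (M.pos b)).drop (M.pos a + 1) := by
      have hl : (M.pos a : ℕ) < (w.take (M.pos b)).length := by simp; omega
      conv_lhs => rw [← List.take_append_drop (M.pos a) (w.take (M.pos b)),
        List.drop_eq_getElem_cons hl]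
      simp
    rw [List.take_take, min_eq_left hlt'.le, hi] at h2
    rw [hj] at h1
    conv_lhs => rw [h1, h2]
    simp
  have hmid : ∀ x ∈ (w.take (M.pos b)).drop (M.pos a + 1),
      x.Far (Letter.c i) ∨ x = Letter.c i := by
    intro x hx
    obtain ⟨r, hr, rfl⟩ := List.mem_drop_iff_getElem.1 hx
    have hr' : M.pos a + 1 + r < M.pos b := by
      simp only [List.length_take] at hr
      omega
    have := hbetween ⟨M.pos a + 1 + r, by omega⟩ (Fin.lt_def.2 (by simp; omega))
      (Fin.lt_def.2 (by simpa using hr'))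
    simpa using this
  apply hw' i (w.take (M.pos a)) ((w.take (M.pos b)).drop (M.pos a + 1) ++ w.drop (M.pos b + 1))
  conv_rhs => rw [hsplit]
  have := toSkel_append_cons hmid (w.drop (M.pos b + 1))
  calc _ = toSkel (w.take (M.pos a)) * toSkel [Letter.c i] * toSkel (Letter.c i ::
      ((w.take (M.pos b)).drop (M.pos a + 1) ++ w.drop (M.pos b + 1))) := by
        simp [← toSkel_append]
    _ = _ := by rw [← this]; simp [← toSkel_append]

variable [Finite α]

theorem isCloneSet_iff (hw : ∀ l w', toSkel (l :: w') = toSkel w → l.base = 1)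
    (hw' : ∀ i u v, toSkel (u ++ [Letter.c i, Letter.c i] ++ v) ≠ toSkel w) (Y : Set α) :
    IsCloneSet Y ↔ ∃ p, (w.get p).base = (w.get p).peak ∧ {x | M.pos x = p} = Y := by
  have key : ∀ a : α, NotInTanglePart a →
      {x | M.pos x = M.pos a} = {b | NotInTanglePart b ∧ view b = view a} := by
    intro a ha
    rw [notInTanglePart_iff M] at ha
    ext x
    simp only [Set.mem_ofPred_eq, notInTanglePart_iff M]
    constructor
    · intro hp
      have h1 := M.up_le a
      have h2 := M.up_le x
      have h3 := M.tag_le a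
      have h4 := M.tag_le x
      rw [hp] at h2 h4
      rw [M.ext hp (by omega) (by omega)]
      exact ⟨ha, rfl⟩
    · rintro ⟨hx, hv⟩
      exact le_antisymm (not_lt.1 (M.pos_not_lt_of_view_eq hw hw' ha hx hv.symm))
        (not_lt.1 (M.pos_not_lt_of_view_eq hw hw' hx ha hv))
  constructor
  · rintro ⟨a, ha, rfl⟩
    exact ⟨M.pos a, (M.notInTanglePart_iff a).1 ha, key a ha⟩
  · rintro ⟨p, hp, rfl⟩
    obtain ⟨a, rfl, -, -⟩ := M.exists_vertex p 0 0 (Letter.base_le_peak _) (Letter.base_le_peak _)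
    have ha := (M.notInTanglePart_iff a).2 hp
    exact ⟨a, ha, key a ha⟩

theorem compatibleListing (hw : ∀ l w', toSkel (l :: w') = toSkel w → l.base = 1)
    (hw' : ∀ i u v, toSkel (u ++ [Letter.c i, Letter.c i] ++ v) ≠ toSkel w) :
    CompatibleListing fun p => {x | M.pos x = p} := by
  refine ⟨fun p q hpq => ?_, fun Y => ?_, ?_⟩
  · obtain ⟨a, ha, -, -⟩ := M.exists_vertex p 0 0 (Letter.base_le_peak _) (Letter.base_le_peak _)
    exact ha.symm.trans ((Set.ext_iff.1 hpq a).1 ha)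
  · rw [IsPart, M.isCloneSet_iff hw hw', M.isTangle_iff, ← exists_or]
    refine exists_congr fun p => ?_
    rw [← or_and_right]
    exact and_iff_right (eq_or_lt_of_le (Letter.base_le_peak _))
  · rintro _ _ hij a rfl b rfl
    have := Fin.val_ne_of_ne hij
    rw [M.level_eq hw, M.level_eq hw, M.lt_iff_lev, Fin.lt_def]
    omega

theorem letterMatches (hw : ∀ l w', toSkel (l :: w') = toSkel w → l.base = 1)
    (hw' : ∀ i u v, toSkel (u ++ [Letter.c i, Letter.c i] ++ v) ≠ toSkel w)
    (p : Fin w.length) : LetterMatches {x | M.pos x = p} (w.get p) := by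
  cases hl : w.get p with
  | c i =>
    refine Or.inl ⟨i, (M.isCloneSet_iff hw hw' _).2
      ⟨p, by rw [hl]; rfl, rfl⟩, ?_, rfl⟩
    rintro a rfl
    have := M.up_le a
    rw [M.level_eq hw, lev]
    rw [hl] at this ⊢
    simp only [Letter.base, Letter.peak] at this ⊢
    omega
  | t i =>
    have hp : (w.get p).base < (w.get p).peak := by rw [hl]; exact Nat.lt_succ_self _
    refine Or.inr ⟨i, ⟨_, _, (M.isTopOfTangle_iff _).2 ⟨p, hp, rfl⟩,
      (M.isBottomOfTangle_iff _).2 ⟨p, hp, rfl⟩, (M.matched_iff hp).2 rfl, M.setOf_pos_eq p,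
      ?_, ?_⟩, rfl⟩
    · rintro a ⟨rfl, ha⟩
      rw [M.level_eq hw, lev, hl, ha]
      rfl
    · rintro a ⟨rfl, ha⟩
      rw [M.level_eq hw, lev, hl, ha]
      rfl

end WordModel

/-- The vertices of the poset realizing a word. -/
abbrev Vertex (w : List Letter) : Type :=
  {x : Fin w.length × Fin 2 × Fin 2 //
    (w.get x.1).base + x.2.1 ≤ (w.get x.1).peak ∧ (w.get x.1).base + x.2.2 ≤ (w.get x.1).peak}

/-- The strict order on the vertices of the poset realizing a word. -/
def Vertex.Lt {w : List Letter} (x y : Vertex w) : Prop :=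
  (w.get x.1.1).base + (x.1.2.1 : ℕ) + 2 ≤ (w.get y.1.1).base + y.1.2.1 ∨
    ((w.get x.1.1).base + (x.1.2.1 : ℕ) + 1 = (w.get y.1.1).base + y.1.2.1 ∧
      ((x.1.1 : ℕ) < y.1.1 ∨ ((x.1.1 : ℕ) = y.1.1 ∧ (x.1.2.2 : ℕ) = y.1.2.2)))

theorem Vertex.Lt.irrefl {w : List Letter} (x : Vertex w) : ¬ x.Lt x := by
  unfold Vertex.Lt
  omega

theorem Vertex.Lt.trans {w : List Letter} {x y z : Vertex w} (h : x.Lt y) (h' : y.Lt z) :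
    x.Lt z := by
  unfold Vertex.Lt at *
  omega

theorem exists_wordModel (w : List Letter) :
    ∃ (n : ℕ) (_ : PartialOrder (Fin n)), Nonempty (WordModel w (Fin n)) := by
  obtain ⟨n, ⟨e⟩⟩ := Finite.exists_equiv_fin (Vertex w)
  let f := e.symm
  have : IsStrictOrder (Fin n) fun a b => (f a).Lt (f b) :=
    { irrefl := fun a => Vertex.Lt.irrefl (f a)
      trans := fun _ _ _ h h' => h.trans h' }
  refine ⟨n, partialOrderOfSO fun a b => (f a).Lt (f b), ⟨?_⟩⟩
  letI := partialOrderOfSO fun a b => (f a).Lt (f b)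
  exact
    { pos := fun a => (f a).1.1
      up := fun a => (f a).1.2.1
      tag := fun a => (f a).1.2.2
      ext := fun hp hu ht => f.injective
        (Subtype.ext (Prod.ext hp (Prod.ext (Fin.ext hu) (Fin.ext ht))))
      up_le := fun a => (f a).2.1
      tag_le := fun a => (f a).2.2
      exists_vertex := fun p s k hs hk => by
        have := (w.get p).peak_le_base_add_one
        exact ⟨e ⟨(p, ⟨s, by omega⟩, ⟨k, by omega⟩), hs, hk⟩, by simp [f]⟩
      lt_iff := fun _ _ => Iff.rfl }

end Construction

/-- An element `m` of the trace monoid `M` is the skeleton of some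
finite `(3+1)`-free poset if and only if (i) every word in `Σ*` representing `m` starts
with the letter `c_1` or `t_1`, and (ii) no word representing `m` contains a factor
`c_i c_i`. -/
theorem skeleton_characterization (m : SkelMonoid) :
    (∃ (n : ℕ) (inst : PartialOrder (Fin n)),
      @ThreePlusOneFree (Fin n) inst ∧ @IsSkeletonOf (Fin n) _ inst m) ↔
    ((∀ w : List Letter, toSkel w = m → ∀ l : Letter, ∀ w' : List Letter,
        w = l :: w' → (l = Letter.c 1 ∨ l = Letter.t 1)) ∧
     (∀ w : List Letter, toSkel w = m → ∀ (i : ℕ+) (u v : List Letter),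
        w ≠ u ++ [Letter.c i, Letter.c i] ++ v)) := by
  constructor
  · rintro ⟨n, inst, -, w, X, hX, hm, rfl⟩
    have h := hX.isListingWord hm
    constructor
    · rintro w' hw' l v rfl
      exact Letter.base_eq_one_iff.1 ((isListingWord_iff_of_toSkel_eq hw').2 h).base_head
    · rintro w' hw' i u v rfl
      exact not_isListingWord_of_c_c i u v ((isListingWord_iff_of_toSkel_eq hw').2 h)
  · rintro ⟨h₁, h₂⟩
    obtain ⟨w, rfl⟩ := toSkel_surjective m
    obtain ⟨n, inst, ⟨M⟩⟩ := exists_wordModel w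
    have hw : ∀ l w', toSkel (l :: w') = toSkel w → l.base = 1 := fun l w' h =>
      Letter.base_eq_one_iff.2 (h₁ _ h l w' rfl)
    have hw' : ∀ i u v, toSkel (u ++ [Letter.c i, Letter.c i] ++ v) ≠ toSkel w :=
      fun i u v h => h₂ _ h i u v rfl
    exact ⟨n, inst, M.threePlusOneFree, w, _, M.compatibleListing hw hw', M.letterMatches hw hw',
      rfl⟩
end

section
/- There is exactly one formal power series S in ℚ[[c, t]] satisfying the equation S = 1 + c·(1 + c)^{-1}·S² + t·S³, where (1 + c)^{-1} denotes the multiplicative inverse of the power series 1 + c in ℚ[[c, t]]. -/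
namespace MvPowerSeries

variable {σ R : Type*} [CommRing R]

theorem le_order_sub {n : ℕ∞} {f g : MvPowerSeries σ R} (hf : n ≤ f.order) (hg : n ≤ g.order) :
    n ≤ (f - g).order := by
  refine le_order fun d hd => ?_
  rw [map_sub, coeff_of_lt_order (hd.trans_le hf), coeff_of_lt_order (hd.trans_le hg), sub_zero]

/-- A self-map of a ring of formal power series that strictly raises the order of differences
has exactly one fixed point. -/
theorem existsUnique_fixedPoint (F : MvPowerSeries σ R → MvPowerSeries σ R)
    (hF : ∀ f g, (f - g).order + 1 ≤ (F f - F g).order) : ∃! f, f = F f := by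
  have step (n : ℕ) : (n : ℕ∞) ≤ (F^[n + 1] 0 - F^[n] 0).order := by
    induction n with
    | zero => simp
    | succ n ih =>
      have h := hF (F^[n + 1] 0) (F^[n] 0)
      rw [← Function.iterate_succ_apply' F, ← Function.iterate_succ_apply' F] at h
      exact le_trans (by push_cast; gcongr) h
  have cauchy (n k : ℕ) : (n : ℕ∞) ≤ (F^[n + k] 0 - F^[n] 0).order := by
    induction k with
    | zero => simp
    | succ k ih =>
      have h := (Nat.cast_le (α := ℕ∞).mpr (Nat.le_add_right n k)).trans (step (n + k))
      rw [← add_assoc, ← sub_add_sub_cancel _ (F^[n + k] 0)]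
      exact (le_min h ih).trans min_order_le_add
  let S : MvPowerSeries σ R := fun d => coeff d (F^[d.degree + 1] 0)
  have approx (n : ℕ) : (n : ℕ∞) ≤ (S - F^[n] 0).order := by
    refine le_order fun d hd => ?_
    obtain ⟨k, rfl⟩ := Nat.exists_eq_add_of_le (Nat.succ_le_of_lt (Nat.cast_lt.mp hd))
    have h : coeff d (F^[d.degree + 1 + k] 0 - F^[d.degree + 1] 0) = 0 :=
      coeff_of_lt_order ((Nat.cast_lt.mpr (Nat.lt_succ_self _)).trans_le (cauchy _ k))
    rw [map_sub, sub_eq_zero] at h ⊢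
    exact h.symm
  have hS : S = F S := by
    rw [← sub_eq_zero, ← order_eq_top_iff, ENat.eq_top_iff_forall_ge]
    intro n
    have h : (n : ℕ∞) ≤ (F S - F (F^[n] 0)).order :=
      ((approx n).trans le_self_add).trans (hF _ _)
    rw [← Function.iterate_succ_apply' F n] at h
    rw [← sub_sub_sub_cancel_right S (F S) (F^[n + 1] 0)]
    exact le_order_sub ((Nat.cast_le.mpr n.le_succ).trans (approx (n + 1))) h
  refine ⟨S, hS, fun T hT => ?_⟩
  have h := hF T S
  rw [← hT, ← hS] at h
  rw [← sub_eq_zero, ← order_eq_top_iff]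
  by_contra hne
  exact h.not_gt (ENat.lt_add_one_iff hne |>.mpr le_rfl)

end MvPowerSeries

/-- There is exactly one formal power series `S` in `ℚ[[c, t]]`
(two commuting variables `c = X 0` and `t = X 1`) satisfying
`S = 1 + c (1+c)⁻¹ S² + t S³`, where `(1+c)⁻¹` is the multiplicative inverse of `1 + c`
in `ℚ[[c, t]]`. -/
theorem unique_solution_skeleton_equation :
    ∃! S : MvPowerSeries (Fin 2) ℚ,
      S = 1 + (MvPowerSeries.X 0) *
            (1 + MvPowerSeries.X 0 : MvPowerSeries (Fin 2) ℚ)⁻¹ * S ^ 2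
          + (MvPowerSeries.X 1) * S ^ 3 := by
  refine MvPowerSeries.existsUnique_fixedPoint
    (fun S => 1 + MvPowerSeries.X 0 * (1 + MvPowerSeries.X 0)⁻¹ * S ^ 2 + MvPowerSeries.X 1 * S ^ 3)
    fun f g => ?_
  set a : MvPowerSeries (Fin 2) ℚ := MvPowerSeries.X 0 * (1 + MvPowerSeries.X 0)⁻¹ * (f + g)
    + MvPowerSeries.X 1 * (f ^ 2 + f * g + g ^ 2) with ha
  have h : 1 ≤ a.order := by
    rw [MvPowerSeries.one_le_order_iff_constCoeff_eq_zero]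
    simp [ha]
  calc (f - g).order + 1 ≤ (f - g).order + a.order := by gcongr
    _ ≤ ((f - g) * a).order := MvPowerSeries.le_order_mul
    _ = _ := by rw [ha]; congr 1; ring
end

section
/- Let τ(i, j) be the number of relations R ⊆ Fin i × Fin j that are tangles. Then, as formal power series in ℚ[[x, y]], Σ_{i,j ≥ 0} τ(i, j) x^i y^j / (i! j!) = e^{−x} + e^{−y} − 1 − (Σ_{i,j ≥ 0} 2^{ij} x^i y^j / (i! j!))^{-1}, where e^{−x} denotes Σ_{n ≥ 0} (−1)^n x^n / n! and e^{−y} is defined analogously. -/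
/-- The neighbourhood in `Fin j` of a top vertex `u` of a bicoloured graph
`R ⊆ Fin i × Fin j`. -/
def topNbhd {i j : ℕ} (R : Set (Fin i × Fin j)) (u : Fin i) : Set (Fin j) :=
  {v | (u, v) ∈ R}

/-- The neighbourhood in `Fin i` of a bottom vertex `v` of a bicoloured graph
`R ⊆ Fin i × Fin j`. -/
def botNbhd {i j : ℕ} (R : Set (Fin i × Fin j)) (v : Fin j) : Set (Fin i) :=
  {u | (u, v) ∈ R}

/-- `u ⊤⊤ u'` for top vertices: their neighbourhoods are incomparable under inclusion. -/
def TTbg {i j : ℕ} (R : Set (Fin i × Fin j)) (u u' : Fin i) : Prop :=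
  ¬ topNbhd R u ⊆ topNbhd R u' ∧ ¬ topNbhd R u' ⊆ topNbhd R u

/-- `v ⊥⊥ v'` for bottom vertices: their neighbourhoods are incomparable under
inclusion. -/
def BBbg {i j : ℕ} (R : Set (Fin i × Fin j)) (v v' : Fin j) : Prop :=
  ¬ botNbhd R v ⊆ botNbhd R v' ∧ ¬ botNbhd R v' ⊆ botNbhd R v

/-- A bicoloured graph `R ⊆ Fin i × Fin j` is a tangle if `i ≥ 2`, `j ≥ 2`, the graph on
`Fin i` with edge relation `⊤⊤` is connected, and the graph on `Fin j` with edge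
relation `⊥⊥` is connected. -/
def IsTangleBG {i j : ℕ} (R : Set (Fin i × Fin j)) : Prop :=
  2 ≤ i ∧ 2 ≤ j ∧ (∀ u u' : Fin i, Relation.ReflTransGen (TTbg R) u u') ∧
    (∀ v v' : Fin j, Relation.ReflTransGen (BBbg R) v v')

/-- Isomorphism of bicoloured graphs: a pair of permutations of the top and bottom
vertices carrying one edge set to the other. -/
def BGIso {i j : ℕ} (R R' : Set (Fin i × Fin j)) : Prop :=
  ∃ (σ : Equiv.Perm (Fin i)) (τ : Equiv.Perm (Fin j)),
    ∀ (u : Fin i) (v : Fin j), (u, v) ∈ R ↔ (σ u, τ v) ∈ R'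

/-- The number `τ(i,j)` of relations `R ⊆ Fin i × Fin j` that are tangles. -/
noncomputable def tauCount (i j : ℕ) : ℕ :=
  Nat.card {R : Set (Fin i × Fin j) // IsTangleBG R}

/-- The exponential generating function `Σ τ(i,j) x^i y^j / (i! j!)` for labelled
tangles. -/
noncomputable def Tlbl : MvPowerSeries (Fin 2) ℚ :=
  fun d => (tauCount (d 0) (d 1) : ℚ) / ((Nat.factorial (d 0)) * (Nat.factorial (d 1)))

/-- The exponential generating function `Σ 2^{ij} x^i y^j / (i! j!)` for labelled
bicoloured graphs. -/
noncomputable def Blbl : MvPowerSeries (Fin 2) ℚ :=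
  fun d => (2 ^ ((d 0) * (d 1)) : ℚ) / ((Nat.factorial (d 0)) * (Nat.factorial (d 1)))

/-- The power series `e^{-x} = Σ_{n ≥ 0} (-1)^n x^n / n!` in `ℚ[[x, y]]`. -/
noncomputable def expNegX : MvPowerSeries (Fin 2) ℚ :=
  fun d => if d 1 = 0 then ((-1 : ℚ) ^ (d 0)) / (Nat.factorial (d 0)) else 0

/-- The power series `e^{-y} = Σ_{n ≥ 0} (-1)^n y^n / n!` in `ℚ[[x, y]]`. -/
noncomputable def expNegY : MvPowerSeries (Fin 2) ℚ :=
  fun d => if d 0 = 0 then ((-1 : ℚ) ^ (d 1)) / (Nat.factorial (d 1)) else 0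

/-- Incomparability of the neighbourhoods of two top vertices, for an arbitrary relation. -/
def TopIncomparable {α β : Type*} (R : α → β → Prop) (u u' : α) : Prop :=
  (¬ ∀ v, R u v → R u' v) ∧ ¬ ∀ v, R u' v → R u v

/-- The tangle property for a relation between arbitrary types. -/
def IsTangleRel {α β : Type*} (R : α → β → Prop) : Prop :=
  2 ≤ Nat.card α ∧ 2 ≤ Nat.card β ∧
    (∀ u u', Relation.ReflTransGen (TopIncomparable R) u u') ∧
    (∀ v v', Relation.ReflTransGen (TopIncomparable fun v u => R u v) v v')

/-- The pair `(A, C)` cuts `R` if `A` is completely joined to the complement of `C`, while the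
complement of `A` is not joined to `C` at all. -/
def IsCut {α β : Type*} (R : α → β → Prop) (A : Set α) (C : Set β) : Prop :=
  (∀ a ∈ A, ∀ c ∉ C, R a c) ∧ ∀ a ∉ A, ∀ c ∈ C, ¬ R a c

/-- The pair `(A, C)` cuts `R` and induces a tangle. -/
def IsTangleCut {α β : Type*} (R : α → β → Prop) (A : Set α) (C : Set β) : Prop :=
  IsCut R A C ∧ IsTangleRel fun (a : A) (c : C) => R a c

/-- The complement of the transpose of a relation. -/
def dualRel {α β : Type*} (R : α → β → Prop) (v : β) (u : α) : Prop := ¬ R u v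

section

variable {α β : Type*} {R : α → β → Prop}

lemma TopIncomparable.symm {u u' : α} (h : TopIncomparable R u u') :
    TopIncomparable R u' u := ⟨h.2, h.1⟩

lemma reflTransGen_topIncomparable_symm {u u' : α}
    (h : Relation.ReflTransGen (TopIncomparable R) u u') :
    Relation.ReflTransGen (TopIncomparable R) u' u :=
  Relation.ReflTransGen.mono (fun _ _ h => TopIncomparable.symm h) _ _
    (Relation.reflTransGen_swap.1 h)

lemma topIncomparable_dualRel :
    TopIncomparable (dualRel R) = TopIncomparable fun v u => R u v := by
  funext v v'
  simp only [TopIncomparable, dualRel, not_imp_not]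
  exact propext and_comm

lemma topIncomparable_swap_dualRel :
    TopIncomparable (fun u v => dualRel R v u) = TopIncomparable R := by
  funext u u'
  simp only [TopIncomparable, dualRel, not_imp_not]
  exact propext and_comm

lemma IsTangleRel.dual (h : IsTangleRel R) : IsTangleRel (dualRel R) := by
  refine ⟨h.2.1, h.1, ?_, ?_⟩
  · rw [topIncomparable_dualRel]; exact h.2.2.2
  · rw [topIncomparable_swap_dualRel]; exact h.2.2.1

lemma IsCut.dual {A : Set α} {C : Set β} (h : IsCut R A C) : IsCut (dualRel R) C A :=
  ⟨fun c hc a ha => h.2 a ha c hc, fun c hc a ha hn => hn (h.1 a ha c hc)⟩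

lemma IsTangleCut.dual {A : Set α} {C : Set β} (h : IsTangleCut R A C) :
    IsTangleCut (dualRel R) C A :=
  ⟨h.1.dual, h.2.dual⟩

lemma IsCut.imp_of_notMem {A : Set α} {C : Set β} (h : IsCut R A C) {a u : α} (ha : a ∈ A)
    (hu : u ∉ A) {v : β} (huv : R u v) : R a v := by
  by_cases hv : v ∈ C
  · exact absurd huv (h.2 u hu v hv)
  · exact h.1 a ha v hv

lemma IsTangleRel.exists_topIncomparable (h : IsTangleRel R) (u : α) :
    ∃ u', TopIncomparable R u u' := by
  have : Finite α := Nat.finite_of_card_ne_zero (by have := h.1; omega)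
  have : Nontrivial α := Finite.one_lt_card_iff_nontrivial.1 h.1
  obtain ⟨w, hw⟩ := exists_ne u
  rcases (h.2.2.1 u w).cases_head with h' | ⟨c, hc, -⟩
  · exact absurd h'.symm hw
  · exact ⟨c, hc⟩

lemma IsTangleRel.nonempty (h : IsTangleRel R) : Nonempty α := by
  by_contra hn
  have := not_nonempty_iff.1 hn
  have := h.1
  simp at this

lemma TopIncomparable.of_induced {A : Set α} {C : Set β} {a b : A}
    (hab : TopIncomparable (fun (a : A) (c : C) => R a c) a b) :
    TopIncomparable R (a : α) b :=
  ⟨fun hh => hab.1 fun v => hh v, fun hh => hab.2 fun v => hh v⟩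

lemma IsTangleCut.exists_not_rel {A : Set α} {C : Set β} (h : IsTangleCut R A C) (u : α) :
    ∃ v, ¬ R u v := by
  by_cases hu : u ∈ A
  · obtain ⟨u', hu'⟩ := h.2.exists_topIncomparable ⟨u, hu⟩
    by_contra! hn
    exact hu'.2 fun v _ => hn v
  · obtain ⟨c⟩ := h.dual.2.nonempty
    exact ⟨c, h.1.2 u hu c c.2⟩

lemma IsTangleCut.exists_rel {A : Set α} {C : Set β} (h : IsTangleCut R A C) (v : β) :
    ∃ u, R u v := by
  simpa [dualRel] using h.dual.exists_not_rel v

lemma IsTangleCut.subset_left {A A' : Set α} {C C' : Set β} (h : IsTangleCut R A C)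
    (h' : IsTangleCut R A' C') : A ⊆ A' := by
  have hne : ∃ x : A, (x : α) ∈ A' := by
    by_contra! hn
    obtain ⟨a⟩ := h.2.nonempty
    obtain ⟨b, hab⟩ := h.2.exists_topIncomparable a
    obtain ⟨a', ha'⟩ := h'.2.nonempty
    refine hab.of_induced.1 fun v hv => ?_
    exact h.1.imp_of_notMem b.2 (fun hA => hn ⟨a', hA⟩ ha')
      (h'.1.imp_of_notMem ha' (hn a) hv)
  obtain ⟨x, hx⟩ := hne
  intro a ha
  have key : ∀ y : A, Relation.ReflTransGen
      (TopIncomparable fun (a : A) (c : C) => R a c) x y → (y : α) ∈ A' := by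
    intro y hy
    induction hy with
    | refl => exact hx
    | tail _ hbc ih =>
      by_contra hc
      exact hbc.of_induced.2 fun v hv => h'.1.imp_of_notMem ih hc hv
  exact key ⟨a, ha⟩ (h.2.2.2.1 x ⟨a, ha⟩)

lemma IsTangleCut.eq_and_eq {A A' : Set α} {C C' : Set β} (h : IsTangleCut R A C)
    (h' : IsTangleCut R A' C') : A = A' ∧ C = C' :=
  ⟨(h.subset_left h').antisymm (h'.subset_left h),
    (h.dual.subset_left h'.dual).antisymm (h'.dual.subset_left h.dual)⟩

/-- If no proper nonempty set of top vertices is part of a cut, then incomparability connects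
the top vertices. -/
lemma reflTransGen_topIncomparable_of_isCut [Finite α] [Finite β]
    (h : ∀ (A : Set α) (C : Set β), IsCut R A C → A.Nonempty → ∀ a, a ∈ A) (u u' : α) :
    Relation.ReflTransGen (TopIncomparable R) u u' := by
  have : Nonempty α := ⟨u⟩
  obtain ⟨u₀, hu₀⟩ := Finite.exists_max fun u => Set.ncard {v | R u v}
  have hall := h {u | Relation.ReflTransGen (TopIncomparable R) u₀ u}
    {v | ∃ a, Relation.ReflTransGen (TopIncomparable R) u₀ a ∧ ¬ R a v} ?_ ⟨u₀, .refl⟩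
  · have hs : Relation.ReflTransGen (TopIncomparable R) u u₀ :=
      reflTransGen_topIncomparable_symm (hall u)
    exact hs.trans (hall u')
  · refine ⟨fun a ha c hc => ?_, fun w hw c hc hwc => ?_⟩
    · by_contra hn
      exact hc ⟨a, ha, hn⟩
    · obtain ⟨a, ha, hac⟩ := hc
      have hcomp : ∀ b, Relation.ReflTransGen (TopIncomparable R) u₀ b →
          (∀ v, R w v → R b v) ∨ ∀ v, R b v → R w v := by
        intro b hb
        by_contra! hn
        refine hw (hb.tail ⟨?_, ?_⟩)
        · push Not; exact hn.2
        · push Not; exact hn.1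
      have key : ∀ b, Relation.ReflTransGen (TopIncomparable R) u₀ b → ∀ v, R w v → R b v := by
        intro b hb
        induction hb with
        | refl =>
          rcases hcomp u₀ .refl with h1 | h1
          · exact h1
          · have heq : {v | R u₀ v} = {v | R w v} :=
              Set.eq_of_subset_of_ncard_le h1 (hu₀ w) (Set.toFinite _)
            exact fun v hv => (Set.ext_iff.1 heq v).2 hv
        | tail hb hbc ih =>
          rcases hcomp _ (hb.tail hbc) with h1 | h1
          · exact h1
          · exact absurd (fun v hv => ih v (h1 v hv)) hbc.2
      exact hac (key a ha c hwc)

lemma IsCut.of_induced {A : Set α} {C : Set β} (h : IsCut R A C) {A' : Set A} {C' : Set C}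
    (h' : IsCut (fun (a : A) (c : C) => R a c) A' C') :
    IsCut R (Subtype.val '' A') (Subtype.val '' C') := by
  constructor
  · rintro _ ⟨a, ha, rfl⟩ c hc
    by_cases hcC : c ∈ C
    · exact h'.1 a ha ⟨c, hcC⟩ fun hh => hc ⟨_, hh, rfl⟩
    · exact h.1 a a.2 c hcC
  · rintro a ha _ ⟨c, hc, rfl⟩
    by_cases haA : a ∈ A
    · exact h'.2 ⟨a, haA⟩ (fun hh => ha ⟨_, hh, rfl⟩) c hc
    · exact h.2 a haA c c.2

lemma IsCut.nontrivial_and_connected [Finite α] [Finite β] {A : Set α} {C : Set β}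
    (h : IsCut R A C) (hne : A.Nonempty ∨ C.Nonempty)
    (hmin : ∀ A' ⊆ A, ∀ C' ⊆ C, IsCut R A' C' → A'.Nonempty → A ⊆ A')
    (hfull : ∀ u, ∃ v, ¬ R u v) (hempty : ∀ v, ∃ u, R u v) :
    2 ≤ Nat.card A ∧
      ∀ u u', Relation.ReflTransGen (TopIncomparable fun (a : A) (c : C) => R a c) u u' := by
  have memC : ∀ u ∈ A, ∀ v, ¬ R u v → v ∈ C := fun u hu v hv => by
    by_contra hn
    exact hv (h.1 u hu v hn)
  have memA : ∀ v ∈ C, ∀ u, R u v → u ∈ A := fun v hv u hu => by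
    by_contra hn
    exact h.2 u hn v hv hu
  constructor
  · have hA : A.Nonempty := by
      rcases hne with hA | ⟨c, hc⟩
      · exact hA
      · obtain ⟨u, hu⟩ := hempty c
        exact ⟨u, memA c hc u hu⟩
    obtain ⟨a, ha⟩ := hA
    obtain ⟨v, hv⟩ := hfull a
    obtain ⟨u, hu⟩ := hempty v
    have huA := memA v (memC a ha v hv) u hu
    have : Nontrivial A := ⟨⟨a, ha⟩, ⟨u, huA⟩, fun heq => hv (by
      rw [Subtype.mk.injEq] at heq
      rwa [heq])⟩
    exact Finite.one_lt_card
  · refine reflTransGen_topIncomparable_of_isCut fun A' C' hcut hA' a => ?_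
    obtain ⟨x, hx, hxa⟩ := hmin (Subtype.val '' A') (Subtype.coe_image_subset _ _)
      (Subtype.val '' C') (Subtype.coe_image_subset _ _) (h.of_induced hcut)
      (hA'.image _) a.2
    rwa [← Subtype.ext hxa]

lemma exists_isTangleCut [Finite α] [Finite β] (hne : Nonempty α ∨ Nonempty β)
    (hfull : ∀ u, ∃ v, ¬ R u v) (hempty : ∀ v, ∃ u, R u v) :
    ∃ A C, IsTangleCut R A C := by
  obtain ⟨⟨A, C⟩, hmin⟩ := exists_minimal_of_wellFoundedLT
    (fun p : Set α × Set β => IsCut R p.1 p.2 ∧ (p.1.Nonempty ∨ p.2.Nonempty))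
    ⟨(Set.univ, Set.univ), ⟨by simp, by simp⟩,
      by simpa only [Set.nonempty_iff_univ_nonempty] using hne⟩
  have h := hmin.prop
  have hA := h.1.nontrivial_and_connected h.2
    (fun A' hA' C' hC' hc hn =>
      (hmin.le_of_le (y := (A', C')) ⟨hc, .inl hn⟩ ⟨hA', hC'⟩).1) hfull hempty
  have hC := h.1.dual.nontrivial_and_connected h.2.symm
    (fun C' hC' A' hA' hc hn =>
      (hmin.le_of_le (y := (A', C')) ⟨by simpa [dualRel, IsCut] using hc.dual, .inr hn⟩
        ⟨hA', hC'⟩).2)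
    (by simpa [dualRel] using hempty) (by simpa [dualRel] using hfull)
  refine ⟨A, C, h.1, hA.1, hC.1, hA.2, ?_⟩
  have h2 := hC.2
  rwa [show (fun (a : C) (c : A) => dualRel R a c) = dualRel (fun (a : A) (c : C) => R a c)
    from rfl, topIncomparable_dualRel] at h2

lemma IsTangleRel.of_equiv {α' β' : Type*} (e : α ≃ α') (f : β ≃ β') {R' : α' → β' → Prop}
    (hR : ∀ u v, R u v ↔ R' (e u) (f v)) (h : IsTangleRel R) : IsTangleRel R' := by
  refine ⟨(Nat.card_congr e) ▸ h.1, (Nat.card_congr f) ▸ h.2.1, fun u u' => ?_, fun v v' => ?_⟩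
  · have := (h.2.2.1 (e.symm u) (e.symm u')).lift (p := TopIncomparable R') e fun a b hab => by
      simpa [TopIncomparable, hR, f.forall_congr_left] using hab
    simpa [Function.onFun] using this
  · have := (h.2.2.2 (f.symm v) (f.symm v')).lift
      (p := TopIncomparable fun v u => R' u v) f fun a b hab => by
        simpa [TopIncomparable, hR, e.forall_congr_left] using hab
    simpa [Function.onFun] using this

end

lemma card_isTangleRel {α β : Type*} [Finite α] [Finite β] :
    Nat.card {R : α → β → Prop // IsTangleRel R} = tauCount (Nat.card α) (Nat.card β) := by
  let e := Finite.equivFin α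
  let f := Finite.equivFin β
  refine Nat.card_congr
    { toFun := fun R => ⟨{p | R.1 (e.symm p.1) (f.symm p.2)}, ?_⟩
      invFun := fun R => ⟨fun a b => (e a, f b) ∈ R.1, ?_⟩
      left_inv := fun R => by ext; simp
      right_inv := fun R => by ext; simp }
  · have := R.2.of_equiv (R' := fun u v => R.1 (e.symm u) (f.symm v)) e f (by simp)
    simp only [IsTangleRel, Nat.card_fin] at this
    exact this
  · have : IsTangleRel fun u v => (u, v) ∈ R.1 := by
      simp only [IsTangleRel, Nat.card_fin]
      exact R.2
    exact this.of_equiv e.symm f.symm (by simp)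

open Classical in
/-- A relation with tangle cut `(A, C)` is a tangle on `A × C` together with an arbitrary
relation between the complements. -/
noncomputable def isTangleCutEquiv {α β : Type*} (A : Set α) (C : Set β) :
    {R : α → β → Prop // IsTangleCut R A C} ≃
      {R : A → C → Prop // IsTangleRel R} × ((Aᶜ : Set α) → (Cᶜ : Set β) → Prop) where
  toFun R := (⟨fun a c => R.1 a c, R.2.2⟩, fun a c => R.1 a c)
  invFun p := ⟨fun a c =>
    if ha : a ∈ A then if hc : c ∈ C then p.1.1 ⟨a, ha⟩ ⟨c, hc⟩ else True
    else if hc : c ∈ C then False else p.2 ⟨a, ha⟩ ⟨c, hc⟩,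
    ⟨fun a ha c hc => by simp [ha, hc], fun a ha c hc => by simp [ha, hc]⟩, by
      simpa using p.1.2⟩
  left_inv R := by
    ext a c
    by_cases ha : a ∈ A <;> by_cases hc : c ∈ C <;> simp [ha, hc]
    · exact R.2.1.1 a ha c hc
    · exact R.2.1.2 a ha c hc
  right_inv p := by
    refine Prod.ext (Subtype.ext ?_) ?_
    · funext a c
      simp
    · funext a c
      simp [show (a : α) ∉ A from a.2, show (c : β) ∉ C from c.2]

lemma card_rel (α β : Type*) [Finite α] [Finite β] :
    Nat.card (α → β → Prop) = 2 ^ (Nat.card α * Nat.card β) := by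
  rw [Nat.card_fun, Nat.card_fun, Nat.card_eq_fintype_card (α := Prop), Fintype.card_prop,
    ← pow_mul, mul_comm]

lemma card_isTangleCut {n m : ℕ} (A : Finset (Fin n)) (C : Finset (Fin m)) :
    Nat.card {R : Fin n → Fin m → Prop // IsTangleCut R (A : Set (Fin n)) (C : Set (Fin m))} =
      tauCount A.card C.card * 2 ^ ((n - A.card) * (m - C.card)) := by
  rw [Nat.card_congr (isTangleCutEquiv _ _), Nat.card_prod, card_isTangleRel, card_rel]
  simp [← Finset.coe_compl, Nat.card_eq_fintype_card]

open Classical in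
lemma sum_isTangleCut {n m : ℕ} (hnm : n ≠ 0 ∨ m ≠ 0) (R : Fin n → Fin m → Prop) :
    (∑ A : Finset (Fin n), ∑ C : Finset (Fin m), if IsTangleCut R A C then 1 else 0) =
      if (∀ u, ∃ v, ¬ R u v) ∧ (∀ v, ∃ u, R u v) then 1 else 0 := by
  rw [← Finset.sum_product']
  split_ifs with h
  · obtain ⟨A, C, hAC⟩ := exists_isTangleCut (R := R)
      (by simpa [← Fin.pos_iff_nonempty, Nat.pos_iff_ne_zero] using hnm) h.1 h.2
    rw [Finset.sum_eq_single (A.toFinset, C.toFinset)]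
    · simp [hAC]
    · rintro ⟨A', C'⟩ - hne
      refine if_neg fun h' => hne ?_
      obtain ⟨rfl, rfl⟩ := hAC.eq_and_eq h'
      simp
    · simp
  · refine Finset.sum_eq_zero fun p _ => if_neg fun h' => h ⟨h'.exists_not_rel, h'.exists_rel⟩

lemma card_forall_exists_not (n m : ℕ) :
    Nat.card {R : Fin n → Fin m → Prop // ∀ u, ∃ v, ¬ R u v} = (2 ^ m - 1) ^ n := by
  have h : Nat.card {S : Fin m → Prop // ∃ v, ¬ S v} = 2 ^ m - 1 := by
    have h1 : Nat.card {S : Fin m → Prop // S ≠ fun _ => True} = 2 ^ m - 1 := by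
      classical
      simp [Nat.card_eq_fintype_card, Fintype.card_subtype_compl]
    rw [← h1]
    refine Nat.card_congr (Equiv.subtypeEquivRight fun S => ?_)
    simp [funext_iff]
  rw [Nat.card_congr (Equiv.subtypePiEquivPi (p := fun _ (S : Fin m → Prop) => ∃ v, ¬ S v)),
    Nat.card_fun, h, Nat.card_fin]

lemma card_forall_exists (n m : ℕ) :
    Nat.card {R : Fin n → Fin m → Prop // ∀ v, ∃ u, R u v} = (2 ^ n - 1) ^ m := by
  rw [← card_forall_exists_not]
  refine Nat.card_congr
    { toFun := fun R => ⟨dualRel R.1, by simpa [dualRel] using R.2⟩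
      invFun := fun R => ⟨dualRel R.1, by simpa [dualRel] using R.2⟩
      left_inv := fun R => by ext; simp [dualRel]
      right_inv := fun R => by ext; simp [dualRel] }

lemma sum_tauCount {n m : ℕ} (hnm : n ≠ 0 ∨ m ≠ 0) :
    (∑ A : Finset (Fin n), ∑ C : Finset (Fin m),
        tauCount A.card C.card * 2 ^ ((n - A.card) * (m - C.card))) + 2 ^ (n * m) =
      (2 ^ m - 1) ^ n + (2 ^ n - 1) ^ m := by
  classical
  have hN : (∑ A : Finset (Fin n), ∑ C : Finset (Fin m),
        tauCount A.card C.card * 2 ^ ((n - A.card) * (m - C.card))) =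
      (Finset.univ.filter fun R : Fin n → Fin m → Prop =>
        (∀ u, ∃ v, ¬ R u v) ∧ (∀ v, ∃ u, R u v)).card := by
    rw [Finset.card_filter]
    refine Eq.trans ?_ (Finset.sum_congr rfl fun R _ => sum_isTangleCut hnm R)
    conv_rhs => rw [Finset.sum_comm]
    refine Finset.sum_congr rfl fun A _ => ?_
    conv_rhs => rw [Finset.sum_comm]
    refine Finset.sum_congr rfl fun C _ => ?_
    rw [← card_isTangleCut, Nat.card_eq_fintype_card, Fintype.card_subtype, Finset.card_filter]
  have hU : (Finset.univ.filter fun R : Fin n → Fin m → Prop =>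
        (∀ u, ∃ v, ¬ R u v) ∨ (∀ v, ∃ u, R u v)).card = 2 ^ (n * m) := by
    rw [Finset.filter_true_of_mem, Finset.card_univ, ← Nat.card_eq_fintype_card, card_rel,
      Nat.card_fin, Nat.card_fin]
    intro R _
    by_contra! h
    obtain ⟨⟨u, hu⟩, v, hv⟩ := h
    exact hv u (hu v)
  rw [hN, ← hU, ← card_forall_exists_not, ← card_forall_exists, Nat.card_eq_fintype_card,
    Nat.card_eq_fintype_card, Fintype.card_subtype, Fintype.card_subtype, Finset.filter_or,
    Finset.filter_and, add_comm, Finset.card_union_add_card_inter]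

/-- The exponential generating function of a doubly indexed sequence. -/
noncomputable def doubleEgf (f : ℕ → ℕ → ℚ) : MvPowerSeries (Fin 2) ℚ :=
  fun d => f (d 0) (d 1) / ((Nat.factorial (d 0)) * (Nat.factorial (d 1)))

lemma coeff_doubleEgf (f : ℕ → ℕ → ℚ) (d : Fin 2 →₀ ℕ) :
    MvPowerSeries.coeff d (doubleEgf f) =
      f (d 0) (d 1) / ((Nat.factorial (d 0)) * (Nat.factorial (d 1))) := rfl

lemma sum_antidiagonal_fin_two {M : Type*} [AddCommMonoid M] (d : Fin 2 →₀ ℕ)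
    (F : ℕ × ℕ → ℕ × ℕ → M) :
    ∑ p ∈ Finset.HasAntidiagonal.antidiagonal d, F (p.1 0, p.2 0) (p.1 1, p.2 1) =
      ∑ q ∈ Finset.HasAntidiagonal.antidiagonal (d 0),
        ∑ r ∈ Finset.HasAntidiagonal.antidiagonal (d 1), F q r := by
  rw [← Finset.sum_product']
  refine Finset.sum_nbij' (fun p => ((p.1 0, p.2 0), (p.1 1, p.2 1)))
    (fun q => (Finsupp.equivFunOnFinite.symm ![q.1.1, q.2.1],
      Finsupp.equivFunOnFinite.symm ![q.1.2, q.2.2])) ?_ ?_ ?_ ?_ ?_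
  · rintro p hp
    rw [Finset.HasAntidiagonal.mem_antidiagonal] at hp
    simp [← hp]
  · rintro ⟨q, r⟩ h
    simp only [Finset.mem_product, Finset.HasAntidiagonal.mem_antidiagonal] at h ⊢
    ext i
    fin_cases i <;> simp [h]
  · rintro ⟨p, q⟩ _
    refine Prod.ext ?_ ?_ <;> ext i <;> fin_cases i <;> simp
  · rintro ⟨q, r⟩ _
    simp
  · simp

lemma sum_antidiagonal_div_factorial (n : ℕ) (f : ℕ → ℕ → ℚ) :
    ∑ q ∈ Finset.HasAntidiagonal.antidiagonal n, f q.1 q.2 / (q.1.factorial * q.2.factorial) =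
      (∑ A : Finset (Fin n), f A.card (n - A.card)) / n.factorial := by
  have h := Finset.sum_powerset_apply_card (x := (Finset.univ : Finset (Fin n)))
    (fun k => f k (n - k))
  rw [Finset.powerset_univ, Finset.card_univ, Fintype.card_fin] at h
  rw [h, Finset.Nat.sum_antidiagonal_eq_sum_range_succ
    (fun a b => f a b / ((a.factorial : ℚ) * b.factorial)), Finset.sum_div]
  refine Finset.sum_congr rfl fun k hk => ?_
  have hk' : k ≤ n := by simpa [Nat.lt_succ_iff] using hk
  rw [nsmul_eq_mul, Nat.cast_choose ℚ hk']
  have := Nat.factorial_ne_zero n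
  field_simp

lemma doubleEgf_mul (f g : ℕ → ℕ → ℚ) :
    doubleEgf f * doubleEgf g = doubleEgf fun n m =>
      ∑ A : Finset (Fin n), ∑ C : Finset (Fin m),
        f A.card C.card * g (n - A.card) (m - C.card) := by
  ext d
  rw [MvPowerSeries.coeff_mul, coeff_doubleEgf]
  simp only [coeff_doubleEgf]
  rw [sum_antidiagonal_fin_two d fun q r => f q.1 r.1 / (q.1.factorial * r.1.factorial) *
    (g q.2 r.2 / (q.2.factorial * r.2.factorial)), mul_comm ((d 0).factorial : ℚ), ← div_div,
    Finset.sum_div,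
    ← sum_antidiagonal_div_factorial (d 0) fun a b =>
      (∑ C : Finset (Fin (d 1)), f a C.card * g b (d 1 - C.card)) / ((d 1).factorial : ℚ)]
  refine Finset.sum_congr rfl fun q _ => ?_
  rw [← sum_antidiagonal_div_factorial (d 1) fun a b => f q.1 a * g q.2 b, Finset.sum_div]
  refine Finset.sum_congr rfl fun r _ => ?_
  rw [div_mul_div_comm, div_div]
  congr 1
  ring

lemma sum_neg_one_pow_card_mul (n : ℕ) (x : ℚ) :
    ∑ A : Finset (Fin n), (-1) ^ A.card * x ^ (n - A.card) = (x - 1) ^ n := by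
  have h := Finset.sum_pow_mul_eq_add_pow (-1 : ℚ) x (Finset.univ : Finset (Fin n))
  simpa [sub_eq_neg_add] using h

lemma expNegX_mul_Blbl : expNegX * Blbl = doubleEgf fun n m => (2 ^ m - 1) ^ n := by
  have hX : expNegX = doubleEgf fun n m => if m = 0 then (-1) ^ n else 0 := by
    ext d
    rw [coeff_doubleEgf]
    by_cases h : d 1 = 0 <;> simp [MvPowerSeries.coeff_apply, expNegX, h]
  rw [hX, show Blbl = doubleEgf fun n m => 2 ^ (n * m) from rfl, doubleEgf_mul]
  congr 1
  funext n m
  rw [← sum_neg_one_pow_card_mul]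
  refine Finset.sum_congr rfl fun A _ => ?_
  rw [Finset.sum_eq_single ∅]
  · simp [← pow_mul, mul_comm]
  · intro C _ hC
    simp [hC]
  · simp

lemma expNegY_mul_Blbl : expNegY * Blbl = doubleEgf fun n m => (2 ^ n - 1) ^ m := by
  have hY : expNegY = doubleEgf fun n m => if n = 0 then (-1) ^ m else 0 := by
    ext d
    rw [coeff_doubleEgf]
    by_cases h : d 0 = 0 <;> simp [MvPowerSeries.coeff_apply, expNegY, h]
  rw [hY, show Blbl = doubleEgf fun n m => 2 ^ (n * m) from rfl, doubleEgf_mul]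
  congr 1
  funext n m
  rw [← sum_neg_one_pow_card_mul, Finset.sum_eq_single ∅]
  · simp [← pow_mul]
  · intro A _ hA
    simp [hA]
  · simp

lemma tauCount_zero_zero : tauCount 0 0 = 0 := by
  simp [tauCount, IsTangleBG]

lemma Tlbl_mul_Blbl : Tlbl * Blbl + Blbl + 1 = expNegX * Blbl + expNegY * Blbl := by
  have hT : Tlbl * Blbl = doubleEgf fun n m =>
      ∑ A : Finset (Fin n), ∑ C : Finset (Fin m),
        (tauCount A.card C.card : ℚ) * 2 ^ ((n - A.card) * (m - C.card)) :=
    doubleEgf_mul (fun n m => (tauCount n m : ℚ)) fun n m => 2 ^ (n * m)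
  rw [hT, expNegX_mul_Blbl, expNegY_mul_Blbl,
    show Blbl = doubleEgf fun n m => 2 ^ (n * m) from rfl]
  ext d
  simp only [map_add, coeff_doubleEgf, MvPowerSeries.coeff_one]
  by_cases hd : d = 0
  · subst hd
    simp [Subsingleton.elim (default : Finset (Fin 0)) ∅, tauCount_zero_zero]
  · have hnm : d 0 ≠ 0 ∨ d 1 ≠ 0 := by
      by_contra! h
      exact hd (by ext i; fin_cases i <;> simp [h])
    have key := congrArg (Nat.cast : ℕ → ℚ) (sum_tauCount hnm)
    push_cast [Nat.one_le_two_pow] at key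
    rw [if_neg hd, add_zero, ← add_div, key, add_div]

/-- The exponential generating function for labelled tangles equals
`e^{-x} + e^{-y} - 1 - B(x,y)⁻¹`, where `B(x,y) = Σ 2^{ij} x^i y^j/(i! j!)` is the
exponential generating function for labelled bicoloured graphs, as formal power series
in `ℚ[[x, y]]` (with `x = X 0`, `y = X 1`). -/
theorem labelled_tangle_generating_function :
    Tlbl = expNegX + expNegY - 1 - Blbl⁻¹ := by
  have hB : MvPowerSeries.constantCoeff Blbl ≠ 0 := by
    rw [← MvPowerSeries.coeff_zero_eq_constantCoeff_apply]
    simp [MvPowerSeries.coeff_apply, Blbl]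
  have h : expNegX + expNegY - 1 - Tlbl = Blbl⁻¹ := by
    rw [MvPowerSeries.eq_inv_iff_mul_eq_one hB]
    linear_combination -Tlbl_mul_Blbl
  rw [← h]
  ring
end
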